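/- arXiv:1704.00319 — 3 statements merged into one kernel-verified Lean document; each statement's English description precedes it below -/
import Mathlib

section
/- Let X be an infinite-dimensional Banach space such that the spaces ℓ_∞^n, n ∈ ℕ, uniformly embed into X. Then every finite concave metric space embeds isometrically into X. -/
open MeasureTheory
open scoped ENNReal
noncomputable section

/-- The index set of pairs `(i,j)` with `i < j`, indexing the coordinates of
`ℝ^{n(n-1)/2}`. -/
abbrev PairIdx (n : ℕ) := {q : Fin n × Fin n // q.1 < q.2}

/-- `‖v‖_p` for `v ∈ ℝ^n`. -/
def pNorm (p : ℝ) {n : ℕ} (v : Fin n → ℝ) : ℝ := (∑ k, |v k| ^ p) ^ (1 / p)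

/-- The map `F_n : (ℝ^n)^n → ℝ^{n(n-1)/2}`, `F_n(x₁,…,xₙ) = (‖x_i - x_j‖_p^p)_{i<j}`. -/
def Fmap (p : ℝ) (n : ℕ) (x : Fin n → Fin n → ℝ) : PairIdx n → ℝ :=
  fun q => ∑ k, |x q.val.1 k - x q.val.2 k| ^ p

/-- `G_n`: the set of points of `(ℝ^n)^n` where the derivative of `F_n` has full rank
`n(n-1)/2`. -/
def Gset (p : ℝ) (n : ℕ) : Set (Fin n → Fin n → ℝ) :=
  {x | LinearMap.rank (fderiv ℝ (Fmap p n) x).toLinearMap = ((n * (n - 1) / 2 : ℕ) : Cardinal)}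

/-- Property K for an `n`-tuple of points of `ℓ_p` (given by their coordinates). -/
def PropertyKSeq (p : ℝ) (n : ℕ) (x : Fin n → ℕ → ℝ) : Prop :=
  ∃ m : Fin n → ℕ, StrictMono m ∧ (fun i j => x i (m j)) ∈ Gset p n

/-- Property K for an `n`-tuple of points of `ℓ_p^N`. -/
def PropertyKFin (p : ℝ) (n N : ℕ) (x : Fin n → Fin N → ℝ) : Prop :=
  ∃ m : Fin n → Fin N, StrictMono m ∧ (fun i j => x i (m j)) ∈ Gset p n

/-- A Borel set `A` in a (separable) Banach space is Haar null if there is a Borel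
probability measure `μ` with `μ(x + A) = 0` for all `x`. -/
def HaarNull {X : Type*} [AddGroup X] [MeasurableSpace X] (A : Set X) : Prop :=
  ∃ μ : Measure X, IsProbabilityMeasure μ ∧ ∀ x : X, μ ((fun a => x + a) '' A) = 0

/-- `X` uniformly contains the spaces `ℓ_p^m`, `m ∈ ℕ`. -/
def UnifContainsLp (p : ℝ≥0∞) [Fact (1 ≤ p)] (X : Type*) [NormedAddCommGroup X]
    [NormedSpace ℝ X] : Prop :=
  ∃ C : ℝ, 1 ≤ C ∧ ∀ m : ℕ, ∃ (Y : Submodule ℝ X)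
    (T : PiLp p (fun _ : Fin m => ℝ) ≃L[ℝ] Y),
      ‖(T : PiLp p (fun _ : Fin m => ℝ) →L[ℝ] Y)‖ *
        ‖(T.symm : Y →L[ℝ] PiLp p (fun _ : Fin m => ℝ))‖ ≤ C

-- test lp coercion and instances

/-- `X` contains copies of all finite-dimensional sup-norm spaces, through linear maps that do not
decrease the norm and increase it at most by the factor `b`. -/
def ContainsSupWithin (X : Type*) [NormedAddCommGroup X] [NormedSpace ℝ X] (b : ℝ) : Prop :=
  ∀ (ι : Type) [Fintype ι], ∃ T : (ι → ℝ) →ₗ[ℝ] X, ∀ x, ‖x‖ ≤ ‖T x‖ ∧ ‖T x‖ ≤ b * ‖x‖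

lemma containsSupWithin_of_forall_fin {X : Type*} [NormedAddCommGroup X] [NormedSpace ℝ X] {C : ℝ}
    (hX : ∀ m : ℕ, ∃ (Y : Submodule ℝ X) (T : (Fin m → ℝ) ≃L[ℝ] Y),
      ‖(T : (Fin m → ℝ) →L[ℝ] Y)‖ * ‖(T.symm : Y →L[ℝ] (Fin m → ℝ))‖ ≤ C) :
    ContainsSupWithin X C := by
  intro ι _
  obtain ⟨Y, T, hT⟩ := hX (Fintype.card ι)
  let e := Fintype.equivFin ι
  set a := ‖(T.symm : Y →L[ℝ] (Fin (Fintype.card ι) → ℝ))‖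
  let E : (ι → ℝ) →ₗ[ℝ] (Fin (Fintype.card ι) → ℝ) := LinearMap.funLeft ℝ ℝ e.symm
  refine ⟨a • (Y.subtype ∘ₗ (T : (Fin (Fintype.card ι) → ℝ) →ₗ[ℝ] Y) ∘ₗ E), fun x ↦ ?_⟩
  have ha : 0 ≤ a := ContinuousLinearMap.opNorm_nonneg _
  have hval : ‖(a • (Y.subtype ∘ₗ (T : (Fin (Fintype.card ι) → ℝ) →ₗ[ℝ] Y) ∘ₗ E)) x‖
      = a * ‖T (E x)‖ := by
    simp [norm_smul, abs_of_nonneg ha]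
  have hE : ‖E x‖ = ‖x‖ := by
    apply le_antisymm <;> refine (pi_norm_le_iff_of_nonneg (norm_nonneg _)).2 fun i ↦ ?_
    · exact norm_le_pi_norm x (e.symm i)
    · simpa [E, LinearMap.funLeft_apply] using norm_le_pi_norm (E x) (e i)
  rw [hval, ← hE]
  constructor
  · simpa using (T.symm : Y →L[ℝ] (Fin (Fintype.card ι) → ℝ)).le_opNorm (T (E x))
  · have h := (T : (Fin (Fintype.card ι) → ℝ) →L[ℝ] Y).le_opNorm (E x)
    calc a * ‖T (E x)‖ ≤ a * (‖(T : (Fin (Fintype.card ι) → ℝ) →L[ℝ] Y)‖ * ‖E x‖) := by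
          gcongr; exact h
      _ = (‖(T : (Fin (Fintype.card ι) → ℝ) →L[ℝ] Y)‖ * a) * ‖E x‖ := by ring
      _ ≤ C * ‖E x‖ := by gcongr

lemma one_le_of_containsSupWithin {X : Type*} [NormedAddCommGroup X] [NormedSpace ℝ X] {b : ℝ}
    (h : ContainsSupWithin X b) : 1 ≤ b := by
  obtain ⟨T, hT⟩ := h Unit
  have := hT (fun _ ↦ 1)
  have h1 : ‖(fun _ : Unit ↦ (1 : ℝ))‖ = 1 := by simp
  rw [h1] at this
  linarith

/-- One step of James's distortion argument: either the constant can be lowered by the factor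
`1 - δ`, or there is a nearly isometric copy. -/
lemma ContainsSupWithin.improve {X : Type*} [NormedAddCommGroup X] [NormedSpace ℝ X] {b δ : ℝ}
    (h : ContainsSupWithin X b) {κ : Type} [Fintype κ]
    (hκ : ¬ ∃ T : (κ → ℝ) →ₗ[ℝ] X, ∀ x, (1 - 2 * δ) * ‖x‖ ≤ ‖T x‖ ∧ ‖T x‖ ≤ ‖x‖) :
    ContainsSupWithin X ((1 - δ) * b) := by
  classical
  intro ι _
  have hb : 0 < b := by linarith [one_le_of_containsSupWithin h]
  obtain ⟨T, hT⟩ := h (κ × ι)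
  by_contra! hno
  -- `J B` places a function on the block `{B} × ι`.
  let J : κ → (ι → ℝ) →ₗ[ℝ] (κ × ι → ℝ) := fun B ↦
    { toFun := fun x p ↦ if p.1 = B then x p.2 else 0
      map_add' := by intro x y; ext p; by_cases hp : p.1 = B <;> simp [hp]
      map_smul' := by intro c x; ext p; by_cases hp : p.1 = B <;> simp [hp] }
  have hJ : ∀ B x, ‖x‖ ≤ ‖J B x‖ := fun B x ↦
    (pi_norm_le_iff_of_nonneg (norm_nonneg _)).2 fun i ↦ by
      simpa [J] using norm_le_pi_norm (J B x) (B, i)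
  have hblock : ∀ B, ∃ x : ι → ℝ, ‖x‖ ≤ 1 ∧ (1 - δ) * b ≤ ‖T (J B x)‖ := by
    intro B
    obtain ⟨x, hx⟩ := hno (T ∘ₗ J B)
    have hx' := hx ((hJ B x).trans (hT _).1)
    simp only [LinearMap.comp_apply] at hx'
    have hx0 : 0 < ‖x‖ := by
      rw [norm_pos_iff]
      rintro rfl
      simp at hx'
    refine ⟨‖x‖⁻¹ • x, ?_, ?_⟩
    · rw [norm_smul, norm_inv, norm_norm, inv_mul_cancel₀ hx0.ne']
    · rw [map_smul, map_smul, norm_smul, norm_inv, norm_norm, inv_mul_eq_div, le_div_iff₀ hx0]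
      exact hx'.le
  choose w hw1 hw using hblock
  let W : (κ → ℝ) →ₗ[ℝ] (κ × ι → ℝ) :=
    { toFun := fun c p ↦ c p.1 * w p.1 p.2
      map_add' := by intro x y; ext p; simp [add_mul]
      map_smul' := by intro c x; ext p; simp [mul_assoc] }
  have hW : ∀ c, ‖W c‖ ≤ ‖c‖ := fun c ↦
    (pi_norm_le_iff_of_nonneg (norm_nonneg _)).2 fun p ↦ by
      have h1 := norm_le_pi_norm c p.1
      have h2 := (norm_le_pi_norm (w p.1) p.2).trans (hw1 p.1)
      calc ‖c p.1 * w p.1 p.2‖ = ‖c p.1‖ * ‖w p.1 p.2‖ := norm_mul _ _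
        _ ≤ ‖c‖ * 1 := by gcongr
        _ = ‖c‖ := mul_one _
  have hup : ∀ c, ‖T (W c)‖ ≤ b * ‖c‖ := fun c ↦
    (hT _).2.trans (by gcongr; exact hW c)
  have hlow : ∀ c, (1 - 2 * δ) * b * ‖c‖ ≤ ‖T (W c)‖ := by
    intro c
    rcases isEmpty_or_nonempty κ with hemp | hne
    · have : c = 0 := Subsingleton.elim _ _
      simp [this]
    obtain ⟨B, hB⟩ : ∃ B, ‖c B‖ = ‖c‖ := by
      obtain ⟨B, -, hB⟩ := Finset.exists_max_image Finset.univ (fun B ↦ ‖c B‖)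
        Finset.univ_nonempty
      exact ⟨B, le_antisymm (norm_le_pi_norm c B)
        ((pi_norm_le_iff_of_nonneg (norm_nonneg _)).2 fun i ↦ hB i (Finset.mem_univ i))⟩
    -- Flip the sign of every coordinate but `B`.
    let c' : κ → ℝ := fun i ↦ if i = B then c i else - c i
    have hc' : ‖c'‖ ≤ ‖c‖ := (pi_norm_le_iff_of_nonneg (norm_nonneg _)).2 fun i ↦ by
      by_cases hi : i = B <;> simpa [c', hi] using norm_le_pi_norm c _
    have hsum : T (W c) + T (W c') = (2 * c B) • T (J B (w B)) := by
      rw [← map_add, ← map_smul]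
      congr 1
      ext p
      by_cases hp : p.1 = B
      · simp [W, J, c', hp]; ring
      · simp [W, J, c', hp]
    have h1 : 2 * ‖c‖ * ((1 - δ) * b) ≤ ‖T (W c)‖ + ‖T (W c')‖ := by
      calc 2 * ‖c‖ * ((1 - δ) * b) ≤ 2 * ‖c‖ * ‖T (J B (w B))‖ := by gcongr; exact hw B
        _ = ‖T (W c) + T (W c')‖ := by rw [hsum, norm_smul, norm_mul, hB]; simp
        _ ≤ _ := norm_add_le _ _
    have h2 : ‖T (W c')‖ ≤ b * ‖c‖ := (hup c').trans (by gcongr)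
    linarith
  refine hκ ⟨b⁻¹ • (T ∘ₗ W), fun c ↦ ?_⟩
  have hval : ‖(b⁻¹ • (T ∘ₗ W)) c‖ = ‖T (W c)‖ / b := by
    rw [LinearMap.smul_apply, norm_smul, norm_inv, Real.norm_of_nonneg hb.le, inv_mul_eq_div,
      LinearMap.comp_apply]
  rw [hval, le_div_iff₀ hb, div_le_iff₀ hb]
  exact ⟨by linarith [hlow c], by linarith [hup c]⟩

/-- James's distortion theorem for the finite-dimensional sup-norm spaces. -/
lemma ContainsSupWithin.exists_almost_isometry {X : Type*} [NormedAddCommGroup X]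
    [NormedSpace ℝ X] {b : ℝ} (h : ContainsSupWithin X b) (κ : Type) [Fintype κ] {ε : ℝ}
    (hε : 0 < ε) (hε1 : ε < 1) :
    ∃ T : (κ → ℝ) →ₗ[ℝ] X, ∀ x, (1 - ε) * ‖x‖ ≤ ‖T x‖ ∧ ‖T x‖ ≤ ‖x‖ := by
  by_contra hκ
  have hall : ∀ k : ℕ, ContainsSupWithin X ((1 - ε / 2) ^ k * b) := by
    intro k
    induction k with
    | zero => simpa using h
    | succ k ih =>
      rw [pow_succ', mul_assoc]
      exact ih.improve (κ := κ) (by rwa [mul_div_cancel₀ ε two_ne_zero])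
  have hb : 0 < b := by linarith [one_le_of_containsSupWithin h]
  obtain ⟨k, hk⟩ := exists_pow_lt_of_lt_one (inv_pos.2 hb) (show 1 - ε / 2 < 1 by linarith)
  have h1 := one_le_of_containsSupWithin (hall k)
  have h2 : (1 - ε / 2) ^ k * b < b⁻¹ * b := by gcongr
  rw [inv_mul_cancel₀ hb.ne'] at h2
  linarith

/-- If the `q`-th vector `A q` attains its sup norm only at the coordinate `q`, then, after a
suitable rescaling of the coordinates, the images of these vectors under some linear map have
norms exactly `A q q`. -/
lemma exists_rescaling {X : Type*} [NormedAddCommGroup X] [NormedSpace ℝ X] {P : Type} [Fintype P]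
    (hX : ∀ ε : ℝ, 0 < ε → ε < 1 → ∃ T : (P → ℝ) →ₗ[ℝ] X,
      ∀ x, (1 - ε) * ‖x‖ ≤ ‖T x‖ ∧ ‖T x‖ ≤ ‖x‖)
    (A : P → P → ℝ) (hpos : ∀ q, 0 < A q q) (hA : ∀ q q', q' ≠ q → |A q q'| < A q q) :
    ∃ (T : (P → ℝ) →ₗ[ℝ] X) (s : P → ℝ), ∀ q, ‖T (fun q' ↦ (1 + s q') * A q q')‖ = A q q := by
  classical
  obtain ⟨r, hr0, hr1, hr⟩ : ∃ r : ℝ, 0 < r ∧ r < 1 ∧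
      ∀ q q', q' ≠ q → (1 + r) * |A q q'| ≤ (1 - r) * A q q := by
    have hev : ∀ᶠ r in nhdsWithin (0 : ℝ) (Set.Ioi 0),
        ∀ q q', q' ≠ q → (1 + r) * |A q q'| ≤ (1 - r) * A q q := by
      simp only [Filter.eventually_all]
      intro q q' hne
      have hc : Filter.Tendsto (fun r : ℝ ↦ (1 - r) * A q q - (1 + r) * |A q q'|)
          (nhds 0) (nhds ((1 - 0) * A q q - (1 + 0) * |A q q'|)) :=
        Continuous.tendsto (by fun_prop) 0
      have := hc.eventually_const_lt (u := 0) (by linarith [hA q q' hne])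
      filter_upwards [nhdsWithin_le_nhds this] with r hr
      linarith
    obtain ⟨r, hr, hr'⟩ := (hev.and (Ioo_mem_nhdsGT one_pos)).exists
    exact ⟨r, hr'.1, hr'.2, hr⟩
  obtain ⟨T, hT⟩ := hX (r / 16) (by positivity) (by linarith)
  let v : P → (P → ℝ) → P → ℝ := fun q s q' ↦ (1 + s q') * A q q'
  have hv : ∀ q s, ‖s‖ ≤ r → ‖v q s‖ = (1 + s q) * A q q := by
    intro q s hs
    have hsq : ∀ q', -r ≤ s q' ∧ s q' ≤ r := fun q' ↦
      abs_le.1 ((norm_le_pi_norm s q').trans hs)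
    have h0 : 0 ≤ (1 + s q) * A q q := mul_nonneg (by linarith [(hsq q).1]) (hpos q).le
    apply le_antisymm
    · refine (pi_norm_le_iff_of_nonneg h0).2 fun q' ↦ ?_
      by_cases hq : q' = q
      · subst hq
        exact (Real.norm_of_nonneg h0).le
      · calc ‖v q s q'‖ = |1 + s q'| * |A q q'| := abs_mul _ _
          _ ≤ (1 + r) * |A q q'| := by
            gcongr
            rw [abs_of_nonneg] <;> linarith [(hsq q').1, (hsq q').2]
          _ ≤ (1 - r) * A q q := hr q q' hq
          _ ≤ (1 + s q) * A q q := by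
            have := hpos q
            gcongr
            linarith [(hsq q).1]
    · exact (le_abs_self _).trans (norm_le_pi_norm (v q s) q)
  -- The equation to solve is the fixed point equation `G s = s`.
  let g : P → (P → ℝ) → ℝ := fun q s ↦ ‖T (v q s)‖ / A q q - (1 + s q)
  let G : (P → ℝ) → P → ℝ := fun s q ↦ - g q s
  have hg : ∀ q s, ‖s‖ ≤ r → |g q s| ≤ r / 8 := by
    intro q s hs
    have hT' := hT (v q s)
    rw [hv q s hs] at hT'
    have hq := hpos q
    have hsq := abs_le.1 ((norm_le_pi_norm s q).trans hs)
    have h1 : ‖T (v q s)‖ / A q q ≤ 1 + s q := (div_le_iff₀ hq).2 hT'.2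
    have h2 : (1 - r / 16) * (1 + s q) ≤ ‖T (v q s)‖ / A q q :=
      (le_div_iff₀ hq).2 (by linarith [hT'.1])
    have h3 : r / 16 * (1 + s q) ≤ r / 16 * 2 := by gcongr; linarith
    rw [abs_le]
    constructor <;> simp only [g] <;> linarith
  have hconv : ∀ q, ConvexOn ℝ (Metric.ball (0 : P → ℝ) r) (g q) := by
    intro q
    refine ⟨convex_ball _ _, fun x _ y _ a b ha hb hab ↦ ?_⟩
    have hvec : v q (a • x + b • y) = a • v q x + b • v q y := by
      ext q'
      simp only [v, Pi.add_apply, Pi.smul_apply, smul_eq_mul]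
      linear_combination (-(A q q')) * hab
    have hn : ‖T (v q (a • x + b • y))‖ ≤ a * ‖T (v q x)‖ + b * ‖T (v q y)‖ := by
      rw [hvec, map_add, map_smul, map_smul]
      refine (norm_add_le _ _).trans_eq ?_
      rw [norm_smul, norm_smul, Real.norm_of_nonneg ha, Real.norm_of_nonneg hb]
    have hdiv := div_le_div_of_nonneg_right hn (hpos q).le
    simp only [g, Pi.add_apply, Pi.smul_apply, smul_eq_mul]
    rw [add_div, mul_div_assoc, mul_div_assoc] at hdiv
    linarith
  have hlip : ∀ q, LipschitzOnWith (1 / 2) (g q) (Metric.ball 0 (r / 2)) := by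
    intro q
    have := (hconv q).lipschitzOnWith_of_abs_le (half_pos hr0) (M := r / 8)
      (fun a ha ↦ hg q a (by simpa using ha.le))
    have hc : (2 * (r / 8) / (r / 2)).toNNReal = 1 / 2 := by
      rw [show 2 * (r / 8) / (r / 2) = 1 / 2 by field_simp; norm_num]
      ext
      simp
    rwa [sub_half, hc] at this
  have hGlip : LipschitzOnWith (1 / 2) G (Metric.closedBall 0 (r / 4)) := by
    refine LipschitzOnWith.of_dist_le_mul fun x hx y hy ↦ ?_
    refine (dist_pi_le_iff (by positivity)).2 fun q ↦ ?_
    rw [dist_neg_neg]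
    have hsub : Metric.closedBall (0 : P → ℝ) (r / 4) ⊆ Metric.ball 0 (r / 2) :=
      Metric.closedBall_subset_ball (by linarith)
    exact (hlip q).dist_le_mul x (hsub hx) y (hsub hy)
  have hmaps : Set.MapsTo G (Metric.closedBall 0 (r / 4)) (Metric.closedBall 0 (r / 4)) := by
    intro s hs
    rw [mem_closedBall_zero_iff] at hs ⊢
    refine (pi_norm_le_iff_of_nonneg (by positivity)).2 fun q ↦ ?_
    rw [norm_neg]
    exact (hg q s (by linarith)).trans (by linarith)
  have hcontr : ContractingWith (1 / 2) hmaps.restrict :=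
    ⟨by simpa using NNReal.half_lt_self one_ne_zero, hGlip.mapsToRestrict hmaps⟩
  obtain ⟨s, -, hs, -⟩ := hcontr.exists_fixedPoint' Metric.isClosed_closedBall.isComplete hmaps
    (Metric.mem_closedBall_self (by positivity)) (edist_ne_top _ _)
  refine ⟨T, s, fun q ↦ ?_⟩
  have hq : - (‖T (v q s)‖ / A q q - (1 + s q)) = s q := congrFun hs q
  exact (div_eq_one_iff_eq (hpos q).ne').1 (by linarith)

/-- In a concave metric space, the function `x ↦ (d(j, x) - d(i, x)) / 2` strictly decreases the
distance of every pair of distinct points other than `{i, j}`. -/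
lemma abs_half_dist_sub_dist_lt {Z : Type*} [MetricSpace Z]
    (hZ : ∀ x y z : Z, x ≠ y → y ≠ z → x ≠ z → dist x z ≠ dist x y + dist y z)
    {i j k l : Z} (hij : i ≠ j) (hkl : k ≠ l) (h₁ : ¬ (k = i ∧ l = j)) (h₂ : ¬ (k = j ∧ l = i)) :
    |(dist j k - dist i k) / 2 - (dist j l - dist i l) / 2| < dist k l := by
  have hle : ∀ a, |dist a k - dist a l| ≤ dist k l := fun a ↦ by
    simpa [dist_comm] using abs_dist_sub_le k l a
  have hlt : ∀ a, a ≠ k → a ≠ l → |dist a k - dist a l| < dist k l := by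
    intro a hk hl
    refine lt_of_le_of_ne (hle a) fun heq ↦ ?_
    rcases abs_eq (dist_nonneg (x := k) (y := l)) |>.1 heq with h | h
    · exact hZ a l k hl hkl.symm hk (by rw [dist_comm l k]; linarith)
    · exact hZ a k l hk hkl hl (by linarith)
  have hsum : |dist j k - dist j l| + |dist i k - dist i l| < 2 * dist k l := by
    by_cases hj : j ≠ k ∧ j ≠ l
    · linarith [hlt j hj.1 hj.2, hle i]
    · have hi : i ≠ k ∧ i ≠ l := by grind
      linarith [hlt i hi.1 hi.2, hle j]
  have htri := abs_sub (dist j k - dist j l) (dist i k - dist i l)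
  rw [show (dist j k - dist i k) / 2 - (dist j l - dist i l) / 2
    = ((dist j k - dist j l) - (dist i k - dist i l)) / 2 by ring, abs_div, abs_two]
  linarith

/-- If `X` is an infinite-dimensional Banach space uniformly
containing the spaces `ℓ_∞^m` (here `Fin m → ℝ` with the sup norm), then every finite
concave metric space embeds isometrically into `X`. -/
theorem stmt13 (X : Type*) [NormedAddCommGroup X] [NormedSpace ℝ X] [CompleteSpace X]
    (hinf : ¬ FiniteDimensional ℝ X)
    (hX : ∃ C : ℝ, 1 ≤ C ∧ ∀ m : ℕ, ∃ (Y : Submodule ℝ X) (T : (Fin m → ℝ) ≃L[ℝ] Y),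
      ‖(T : (Fin m → ℝ) →L[ℝ] Y)‖ * ‖(T.symm : Y →L[ℝ] (Fin m → ℝ))‖ ≤ C)
    (Z : Type) [MetricSpace Z] [Finite Z]
    (hZ : ∀ x y z : Z, x ≠ y → y ≠ z → x ≠ z → dist x z ≠ dist x y + dist y z) :
    ∃ f : Z → X, Isometry f := by
  obtain ⟨C, -, hC⟩ := hX
  obtain ⟨n, ⟨e⟩⟩ := Finite.exists_equiv_fin Z
  let z : Fin n → Z := e.symm
  have hz : Function.Injective z := e.symm.injective
  let φ : Z → PairIdx n → ℝ := fun x q ↦ (dist (z q.1.2) x - dist (z q.1.1) x) / 2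
  have hdiag : ∀ q : PairIdx n, φ (z q.1.1) q - φ (z q.1.2) q = dist (z q.1.1) (z q.1.2) := by
    intro q
    simp only [φ, dist_self, dist_comm (z q.1.2) (z q.1.1)]
    ring
  obtain ⟨T, s, hs⟩ := exists_rescaling
    (fun ε h0 h1 ↦ (containsSupWithin_of_forall_fin hC).exists_almost_isometry (PairIdx n) h0 h1)
    (fun q q' ↦ φ (z q.1.1) q' - φ (z q.1.2) q')
    (fun q ↦ by rw [hdiag]; exact dist_pos.2 (hz.ne q.2.ne))
    (fun q q' hne ↦ by
      rw [hdiag]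
      refine abs_half_dist_sub_dist_lt hZ (hz.ne q'.2.ne) (hz.ne q.2.ne) ?_ ?_
      · rintro ⟨h, h'⟩
        exact hne (Subtype.ext (Prod.ext (hz h).symm (hz h').symm))
      · rintro ⟨h, h'⟩
        have := q.2
        rw [hz h, hz h'] at this
        exact this.not_gt q'.2)
  let f : Z → X := fun x ↦ T (fun q ↦ (1 + s q) * φ x q)
  have hlt : ∀ a b, a < b → dist (f (z a)) (f (z b)) = dist (z a) (z b) := by
    intro a b hab
    have h := hs ⟨(a, b), hab⟩
    rw [hdiag] at h
    rw [dist_eq_norm, ← map_sub, ← h]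
    congr 2
    ext q
    simp only [Pi.sub_apply]
    ring
  refine ⟨f, Isometry.of_dist_eq fun x y ↦ ?_⟩
  obtain ⟨a, rfl⟩ := e.symm.surjective x
  obtain ⟨b, rfl⟩ := e.symm.surjective y
  rcases lt_trichotomy a b with h | rfl | h
  · exact hlt a b h
  · simp
  · rw [dist_comm, dist_comm (e.symm a)]
    exact hlt b a h
end
end

section
/- Let 1 ≤ p ≤ ∞, C ≥ 1, ε > 0 and k ∈ ℕ. Then there is some n ∈ ℕ (depending on p, C, k and ε) such that if a Banach space X admits a linear isomorphism T : ℓ_p^n → X with ‖T‖·‖T^{-1}‖ ≤ C, then X has a subspace Z admitting a linear isomorphism S : ℓ_p^k → Z with ‖S‖·‖S^{-1}‖ ≤ 1 + ε. -/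
open MeasureTheory
open scoped ENNReal
noncomputable section

-- test lp coercion and instances

open Filter Topology

/-- The limit of a bounded real sequence along a fixed nonprincipal ultrafilter on `ℕ`. -/
def ultralim (f : ℕ → ℝ) : ℝ := limUnder (hyperfilter ℕ : Filter ℕ) f

theorem tendsto_ultralim {f : ℕ → ℝ} {K : ℝ} (h : ∀ᶠ n in hyperfilter ℕ, |f n| ≤ K) :
    Tendsto f (hyperfilter ℕ) (𝓝 (ultralim f)) := by
  obtain ⟨x, -, hx⟩ := (isCompact_Icc (a := -K) (b := K)).ultrafilter_le_nhds
    ((hyperfilter ℕ).map f) (by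
      rw [Ultrafilter.coe_map, le_principal_iff, mem_map]
      exact h.mono fun n hn => abs_le.1 hn)
  exact tendsto_nhds_limUnder ⟨x, hx⟩

theorem ultralim_const (c : ℝ) : ultralim (fun _ => c) = c :=
  tendsto_const_nhds.limUnder_eq

/-- A seminorm on a finite-dimensional normed space that is close to the norm on a suitable
finite set is uniformly close to the norm. -/
theorem exists_finset_seminorm_close (W : Type*) [NormedAddCommGroup W] [NormedSpace ℝ W]
    [FiniteDimensional ℝ W] {η : ℝ} (hη : 0 < η) :
    ∃ (Λ : Finset W) (δ : ℝ), 0 < δ ∧ ∀ Q : Seminorm ℝ W,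
      (∀ a ∈ Λ, |Q a - ‖a‖| ≤ δ) → ∀ a, |Q a - ‖a‖| ≤ η * ‖a‖ := by
  classical
  let b := Module.finBasis ℝ W
  have hc : ∃ c : ℝ, 0 ≤ c ∧ ∀ i a, |b.repr a i| ≤ c * ‖a‖ := by
    refine ⟨∑ i, ‖LinearMap.toContinuousLinearMap (b.coord i)‖,
      Finset.sum_nonneg fun _ _ => norm_nonneg _, fun i a => ?_⟩
    have h1 := (LinearMap.toContinuousLinearMap (b.coord i)).le_opNorm a
    have h2 : ‖LinearMap.toContinuousLinearMap (b.coord i)‖ ≤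
        ∑ i, ‖LinearMap.toContinuousLinearMap (b.coord i)‖ :=
      Finset.single_le_sum (f := fun i => ‖LinearMap.toContinuousLinearMap (b.coord i)‖)
        (fun _ _ => norm_nonneg _) (Finset.mem_univ i)
    calc |b.repr a i| = ‖(LinearMap.toContinuousLinearMap (b.coord i)) a‖ := by simp
      _ ≤ _ := h1.trans (by gcongr)
  obtain ⟨c, hc0, hc⟩ := hc
  set K : ℝ := ∑ i, c * (‖b i‖ + 1) with hK
  have hK0 : 0 ≤ K := Finset.sum_nonneg fun _ _ => by positivity
  set θ : ℝ := η / (2 * (K + 1)) with hθ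
  have hθ0 : 0 < θ := by positivity
  obtain ⟨t, -, ht, hcov⟩ := (isCompact_sphere (0 : W) 1).finite_cover_balls hθ0
  refine ⟨ht.toFinset ∪ Finset.univ.image b, min 1 (η / 2), by positivity, fun Q hQ => ?_⟩
  have hb : ∀ i, Q (b i) ≤ ‖b i‖ + 1 := fun i => by
    have := (abs_le.1 (hQ (b i) (by simp))).2
    linarith [min_le_left 1 (η / 2)]
  have hQK : ∀ a, Q a ≤ K * ‖a‖ := fun a => by
    calc Q a = Q (∑ i, b.repr a i • b i) := by rw [b.sum_repr]
      _ ≤ ∑ i, Q (b.repr a i • b i) := by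
        exact Finset.le_sum_of_subadditive Q (map_zero Q).le (map_add_le_add Q) _ _
      _ ≤ ∑ i, c * (‖b i‖ + 1) * ‖a‖ := Finset.sum_le_sum fun i _ => by
        rw [map_smul_eq_mul, Real.norm_eq_abs]
        calc |b.repr a i| * Q (b i) ≤ (c * ‖a‖) * (‖b i‖ + 1) := by
              gcongr
              · exact hc i a
              · exact hb i
          _ = _ := by ring
      _ = K * ‖a‖ := by rw [hK, Finset.sum_mul]
  have hunit : ∀ a, ‖a‖ = 1 → |Q a - 1| ≤ η := fun a ha => by
    obtain ⟨a', ha', hd⟩ := Set.mem_iUnion₂.1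
      (hcov (by simpa using ha : a ∈ Metric.sphere (0 : W) 1))
    have hd' : ‖a - a'‖ < θ := by simpa [dist_eq_norm] using hd
    have h1 := hQ a' (by simp [ha'])
    have h2 : |Q a - Q a'| ≤ K * θ :=
      (abs_sub_map_le_sub Q a a').trans ((hQK _).trans (by gcongr))
    have h3 : |‖a'‖ - ‖a‖| ≤ θ := by
      rw [abs_sub_comm]; exact (abs_norm_sub_norm_le a a').trans hd'.le
    have h4 : K * θ + θ = η / 2 := by rw [hθ]; field_simp
    have h5 := min_le_right 1 (η / 2)
    rw [ha] at h3
    rw [abs_le] at *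
    constructor <;> linarith [h1.1, h1.2, h2.1, h2.2, h3.1, h3.2]
  intro a
  rcases eq_or_ne a 0 with rfl | ha
  · simp
  have hn : 0 < ‖a‖ := norm_pos_iff.2 ha
  have h1 := hunit (‖a‖⁻¹ • a) (by rw [norm_smul]; simp [hn.ne'])
  rw [map_smul_eq_mul] at h1
  have : Q a - ‖a‖ = ‖a‖ * (‖‖a‖⁻¹‖ * Q a - 1) := by
    simp; field_simp
  rw [this, abs_mul, abs_of_pos hn, mul_comm]
  gcongr

/-- A seminorm on `ℝ^(ℕ)` which is the pointwise ultralimit of seminorms. -/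
def ultralimSeminorm (ν : ℕ → Seminorm ℝ (ℕ →₀ ℝ)) (ρ : (ℕ →₀ ℝ) → ℝ)
    (h : ∀ v, ∀ᶠ n in hyperfilter ℕ, ν n v ≤ ρ v) : Seminorm ℝ (ℕ →₀ ℝ) :=
  have ht : ∀ v, Tendsto (fun n => ν n v) (hyperfilter ℕ) (𝓝 (ultralim fun n => ν n v)) :=
    fun v => tendsto_ultralim (K := ρ v) <| (h v).mono fun n hn => by
      rwa [abs_of_nonneg (apply_nonneg _ _)]
  Seminorm.of (fun v => ultralim fun n => ν n v)
    (fun v w => le_of_tendsto_of_tendsto' (ht _) ((ht v).add (ht w)) fun n =>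
      map_add_le_add _ _ _)
    (fun c v => tendsto_nhds_unique (ht _) (by
      simpa only [map_smul_eq_mul] using (ht v).const_mul ‖c‖))

theorem tendsto_ultralimSeminorm (ν : ℕ → Seminorm ℝ (ℕ →₀ ℝ)) (ρ : (ℕ →₀ ℝ) → ℝ)
    (h : ∀ v, ∀ᶠ n in hyperfilter ℕ, ν n v ≤ ρ v) (v : ℕ →₀ ℝ) :
    Tendsto (fun n => ν n v) (hyperfilter ℕ) (𝓝 (ultralimSeminorm ν ρ h v)) :=
  tendsto_ultralim (K := ρ v) <| (h v).mono fun n hn => by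
    rwa [abs_of_nonneg (apply_nonneg _ _)]

/-- The restriction of a finitely supported sequence to its first `n` coordinates, in `ℓ_p^n`. -/
def restrictLp (p : ℝ≥0∞) (n : ℕ) : (ℕ →₀ ℝ) →ₗ[ℝ] PiLp p (fun _ : Fin n => ℝ) where
  toFun v := WithLp.toLp p fun i => v i
  map_add' v w := by ext; simp
  map_smul' c v := by ext; simp

/-- A linear map from a finite-dimensional space that is almost isometric is an isomorphism
onto its range with small distortion. -/
theorem exists_submodule_of_close {W X : Type*} [NormedAddCommGroup W] [NormedSpace ℝ W]
    [FiniteDimensional ℝ W] [NormedAddCommGroup X] [NormedSpace ℝ X] {ε : ℝ} (hε : 0 < ε)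
    (A : W →ₗ[ℝ] X) (hA : ∀ a, |‖A a‖ - ‖a‖| ≤ ε / (2 + ε) * ‖a‖) :
    ∃ (Z : Submodule ℝ X) (S : W ≃L[ℝ] Z),
      ‖(S : W →L[ℝ] Z)‖ * ‖(S.symm : Z →L[ℝ] W)‖ ≤ 1 + ε := by
  have hη : ε / (2 + ε) < 1 := by rw [div_lt_one (by positivity)]; linarith
  have hinj : Function.Injective A := by
    rw [injective_iff_map_eq_zero]
    intro a ha
    have := hA a
    rw [ha, norm_zero, zero_sub, abs_neg, abs_norm] at this
    by_contra h
    nlinarith [norm_pos_iff.2 h]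
  let S := (LinearEquiv.ofInjective A hinj).toContinuousLinearEquiv
  have hS : ∀ a, ‖S a‖ = ‖A a‖ := fun a => rfl
  refine ⟨A.range, S, ?_⟩
  have h1 : ‖(S : W →L[ℝ] A.range)‖ ≤ 1 + ε / (2 + ε) :=
    ContinuousLinearMap.opNorm_le_bound _ (by positivity) fun a => by
      have := (abs_le.1 (hA a)).2
      change ‖S a‖ ≤ _
      rw [hS]; linarith
  have h2 : ‖(S.symm : A.range →L[ℝ] W)‖ ≤ (1 - ε / (2 + ε))⁻¹ :=
    ContinuousLinearMap.opNorm_le_bound _ (inv_nonneg.2 (by linarith)) fun z => by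
      have h := (abs_le.1 (hA (S.symm z))).1
      have h3 := hS (S.symm z)
      rw [S.apply_symm_apply] at h3
      change ‖S.symm z‖ ≤ _
      rw [h3, inv_mul_eq_div, le_div_iff₀ (by linarith)]
      linarith
  calc _ ≤ (1 + ε / (2 + ε)) * (1 - ε / (2 + ε))⁻¹ := by gcongr
    _ = 1 + ε := by field_simp; ring

/-- It suffices to find almost isometric copies of `ℓ_p^k` in `ℝ^(ℕ)` equipped with a seminorm
equivalent to the `ℓ_p` norm. -/
theorem exists_dim_of_seminorm (p : ℝ≥0∞) [Fact (1 ≤ p)] (C ε : ℝ) (hε : 0 < ε) (k : ℕ)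
    (ρ : (ℕ →₀ ℝ) → ℝ) (hρ : ∀ v, ∀ᶠ n in atTop, ‖restrictLp p n v‖ = ρ v)
    (H : ∀ q : Seminorm ℝ (ℕ →₀ ℝ), (∀ v, q v ≤ ρ v) → (∀ v, ρ v ≤ C * q v) →
      ∀ (Λ : Finset (PiLp p (fun _ : Fin k => ℝ))) (δ : ℝ), 0 < δ →
        ∃ B : PiLp p (fun _ : Fin k => ℝ) →ₗ[ℝ] (ℕ →₀ ℝ), ∀ a ∈ Λ, |q (B a) - ‖a‖| ≤ δ) :
    ∃ n : ℕ, ∀ (X : Type) [NormedAddCommGroup X] [NormedSpace ℝ X] [CompleteSpace X],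
      (∃ T : PiLp p (fun _ : Fin n => ℝ) ≃L[ℝ] X,
        ‖(T : PiLp p (fun _ : Fin n => ℝ) →L[ℝ] X)‖ *
          ‖(T.symm : X →L[ℝ] PiLp p (fun _ : Fin n => ℝ))‖ ≤ C) →
      ∃ (Z : Submodule ℝ X) (S : PiLp p (fun _ : Fin k => ℝ) ≃L[ℝ] Z),
        ‖(S : PiLp p (fun _ : Fin k => ℝ) →L[ℝ] Z)‖ *
          ‖(S.symm : Z →L[ℝ] PiLp p (fun _ : Fin k => ℝ))‖ ≤ 1 + ε := by
  by_contra! hcon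
  choose X i1 i2 i3 hT hno using hcon
  choose T hT using hT
  let J : ∀ n, (ℕ →₀ ℝ) →ₗ[ℝ] X n := fun n =>
    ‖(T n : PiLp p (fun _ : Fin n => ℝ) →L[ℝ] X n)‖⁻¹ •
      ((T n).toLinearEquiv.toLinearMap ∘ₗ restrictLp p n)
  have hJ : ∀ n v, ‖J n v‖ = ‖(T n : PiLp p (fun _ : Fin n => ℝ) →L[ℝ] X n)‖⁻¹ *
      ‖T n (restrictLp p n v)‖ := fun n v => by simp [J, norm_smul]
  have hup : ∀ n v, ‖J n v‖ ≤ ‖restrictLp p n v‖ := fun n v => by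
    rw [hJ]
    exact inv_mul_le_of_le_mul₀ (norm_nonneg _) (norm_nonneg _)
      ((T n : PiLp p (fun _ : Fin n => ℝ) →L[ℝ] X n).le_opNorm _)
  have hlow : ∀ n v, ‖restrictLp p n v‖ ≤ C * ‖J n v‖ := fun n v => by
    rcases eq_or_ne (restrictLp p n v) 0 with h0 | h0
    · rw [hJ, h0]; simp
    have h1 := (T n : PiLp p (fun _ : Fin n => ℝ) →L[ℝ] X n).le_opNorm (restrictLp p n v)
    have h2 := ((T n).symm : X n →L[ℝ] PiLp p (fun _ : Fin n => ℝ)).le_opNorm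
      (T n (restrictLp p n v))
    simp only [ContinuousLinearEquiv.coe_coe, ContinuousLinearEquiv.symm_apply_apply] at h1 h2
    have h3 : 0 < ‖T n (restrictLp p n v)‖ := by simpa using h0
    have h4 : 0 < ‖(T n : PiLp p (fun _ : Fin n => ℝ) →L[ℝ] X n)‖ := by
      by_contra h
      nlinarith [norm_nonneg (restrictLp p n v)]
    rw [hJ, ← mul_assoc, ← div_eq_mul_inv, div_mul_eq_mul_div, le_div_iff₀ h4]
    calc _ ≤ (‖((T n).symm : X n →L[ℝ] PiLp p (fun _ : Fin n => ℝ))‖ *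
            ‖T n (restrictLp p n v)‖) * ‖(T n : PiLp p (fun _ : Fin n => ℝ) →L[ℝ] X n)‖ := by
          gcongr
      _ = (‖(T n : PiLp p (fun _ : Fin n => ℝ) →L[ℝ] X n)‖ *
          ‖((T n).symm : X n →L[ℝ] PiLp p (fun _ : Fin n => ℝ))‖) *
            ‖T n (restrictLp p n v)‖ := by ring
      _ ≤ _ := by gcongr; exact hT n
  let ν : ℕ → Seminorm ℝ (ℕ →₀ ℝ) := fun n => (normSeminorm ℝ (X n)).comp (J n)
  have hρ' : ∀ v, ∀ᶠ n in hyperfilter ℕ, ‖restrictLp p n v‖ = ρ v := fun v =>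
    (hρ v).filter_mono Nat.hyperfilter_le_atTop
  have hν : ∀ v, ∀ᶠ n in hyperfilter ℕ, ν n v ≤ ρ v := fun v => by
    filter_upwards [hρ' v] with n hn
    exact hn ▸ hup n v
  have htend := tendsto_ultralimSeminorm ν ρ hν
  have hη : 0 < ε / (2 + ε) := by positivity
  obtain ⟨Λ, δ, hδ, hΛ⟩ := exists_finset_seminorm_close (PiLp p (fun _ : Fin k => ℝ)) hη
  obtain ⟨B, hB⟩ := H (ultralimSeminorm ν ρ hν) (fun v => le_of_tendsto (htend v) (hν v))
    (fun v => ge_of_tendsto ((htend v).const_mul C) (by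
      filter_upwards [hρ' v] with n hn
      exact hn ▸ hlow n v)) Λ (δ / 2) (by positivity)
  have hev : ∀ᶠ n in hyperfilter ℕ, ∀ a ∈ Λ, |ν n (B a) - ‖a‖| ≤ δ := by
    rw [eventually_all_finset]
    intro a ha
    filter_upwards [(Metric.tendsto_nhds.1 (htend (B a))) (δ / 2) (by positivity)] with n hn
    rw [Real.dist_eq] at hn
    calc |ν n (B a) - ‖a‖| ≤ |ν n (B a) - ultralimSeminorm ν ρ hν (B a)| +
          |ultralimSeminorm ν ρ hν (B a) - ‖a‖| := abs_sub_le _ _ _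
      _ ≤ δ := by linarith [hB a ha]
  obtain ⟨n, hn⟩ := hev.exists
  obtain ⟨Z, S, hS⟩ := exists_submodule_of_close hε (J n ∘ₗ B)
    (hΛ ((normSeminorm ℝ (X n)).comp (J n ∘ₗ B)) hn)
  exact (hno n Z S).not_ge hS

section SupNorm

theorem bddAbove_range_abs_finsupp (v : ℕ →₀ ℝ) : BddAbove (Set.range fun i => |v i|) := by
  simpa only [← Set.range_comp'] using (v.finite_range.image abs).bddAbove

theorem Finsupp.eventually_eq_zero_of_le (v : ℕ →₀ ℝ) : ∀ᶠ n in atTop, ∀ i, n ≤ i → v i = 0 := by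
  filter_upwards [eventually_gt_atTop (v.support.sup id)] with n hn i hi
  by_contra h
  have := Finset.le_sup (f := id) (Finsupp.mem_support_iff.2 h)
  simp only [id] at this
  omega

theorem eventually_norm_restrictLp_top (v : ℕ →₀ ℝ) :
    ∀ᶠ n in atTop, ‖restrictLp ∞ n v‖ = ⨆ i, |v i| := by
  filter_upwards [v.eventually_eq_zero_of_le] with n hn
  rw [PiLp.norm_eq_ciSup]
  have h0 : 0 ≤ ⨆ i, |v i| := Real.iSup_nonneg fun _ => abs_nonneg _
  apply le_antisymm
  · exact Real.iSup_le (fun i => le_ciSup (bddAbove_range_abs_finsupp v) (i : ℕ)) h0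
  · refine Real.iSup_le (fun i => ?_) (Real.iSup_nonneg fun _ => norm_nonneg _)
    rcases lt_or_ge i n with hi | hi
    · exact le_ciSup (f := fun j : Fin n => ‖(restrictLp ∞ n v).ofLp j‖)
        (Set.finite_range _).bddAbove ⟨i, hi⟩
    · rw [hn i hi, abs_zero]
      exact Real.iSup_nonneg fun _ => norm_nonneg _

/-- The James distortion argument: there are disjoint blocks, bounded by `1`, whose seminorm is
almost the largest possible value far out. -/
theorem exists_blocks_of_sup_equiv (q : Seminorm ℝ (ℕ →₀ ℝ)) {C : ℝ}
    (hu : ∀ v, q v ≤ ⨆ i, |v i|) (hl : ∀ v, (⨆ i, |v i|) ≤ C * q v) :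
    ∃ K : ℝ, 0 < K ∧ ∀ δ > 0, ∃ (n₀ : ℕ) (y : ℕ → ℕ →₀ ℝ),
      (∀ v : ℕ →₀ ℝ, (∀ i, |v i| ≤ 1) → (∀ i < n₀, v i = 0) → q v ≤ K + δ) ∧
      (∀ j i, |y j i| ≤ 1) ∧ (∀ j, ∀ i < n₀, y j i = 0) ∧
      (∀ i j j', y j i ≠ 0 → y j' i ≠ 0 → j = j') ∧ ∀ j, K - δ < q (y j) := by
  let A : ℕ → Set ℝ := fun n => q '' {v | (∀ i, |v i| ≤ 1) ∧ ∀ i < n, v i = 0}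
  have hA1 : ∀ n, ∀ x ∈ A n, x ≤ 1 := by
    rintro n _ ⟨v, ⟨hv, -⟩, rfl⟩
    exact (hu v).trans (Real.iSup_le hv zero_le_one)
  have hAb : ∀ n, BddAbove (A n) := fun n => ⟨1, hA1 n⟩
  have hmem : ∀ n, q (Finsupp.single n 1) ∈ A n := fun n =>
    ⟨_, ⟨fun i => by by_cases h : n = i <;> simp [h],
      fun i hi => by simp [hi.ne']⟩, rfl⟩
  have hlow : ∀ n, 1 ≤ C * q (Finsupp.single n 1) := fun n =>
    le_trans (by simpa using le_ciSup (bddAbove_range_abs_finsupp (Finsupp.single n 1)) n)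
      (hl (Finsupp.single n 1))
  have hC : 0 < C := by
    by_contra h
    nlinarith [hlow 0, apply_nonneg q (Finsupp.single 0 1)]
  have hKn : ∀ n, C⁻¹ ≤ sSup (A n) := fun n =>
    le_trans (by rw [inv_le_iff_one_le_mul₀' hC]; exact hlow n) (le_csSup (hAb n) (hmem n))
  have hbdd : BddBelow (Set.range fun n => sSup (A n)) :=
    ⟨C⁻¹, by rintro _ ⟨n, rfl⟩; exact hKn n⟩
  refine ⟨⨅ n, sSup (A n), lt_of_lt_of_le (inv_pos.2 hC) (le_ciInf hKn), fun δ hδ => ?_⟩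
  obtain ⟨n₀, hn₀⟩ := exists_lt_of_ciInf_lt (lt_add_of_pos_right (⨅ n, sSup (A n)) hδ)
  have hex : ∀ n, ∃ v : ℕ →₀ ℝ, ∃ m, n ≤ m ∧ (∀ i, |v i| ≤ 1) ∧ (∀ i < n, v i = 0) ∧
      (∀ i, m ≤ i → v i = 0) ∧ (⨅ n, sSup (A n)) - δ < q v := fun n => by
    obtain ⟨_, ⟨v, ⟨hv1, hv2⟩, rfl⟩, hv⟩ := exists_lt_of_lt_csSup ⟨_, hmem n⟩
      (lt_of_lt_of_le (sub_lt_self _ hδ) (ciInf_le hbdd n))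
    obtain ⟨m, hm, hnm⟩ := (v.eventually_eq_zero_of_le.and (eventually_ge_atTop n)).exists
    exact ⟨v, m, hnm, hv1, hv2, hm, hv⟩
  choose Y M hnM hY1 hY0 hYM hYq using hex
  let s : ℕ → ℕ := fun j => Nat.rec n₀ (fun _ n => M n) j
  have hs : Monotone s := monotone_nat_of_le_succ fun j => hnM (s j)
  have hs' : ∀ {i j}, Y (s j) i ≠ 0 → s j ≤ i ∧ i < s (j + 1) := fun {i j} h =>
    ⟨not_lt.1 fun h' => h (hY0 _ _ h'), not_le.1 fun h' => h (hYM _ _ h')⟩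
  refine ⟨n₀, fun j => Y (s j), fun v hv1 hv0 => (le_csSup (hAb n₀) ⟨v, ⟨hv1, hv0⟩, rfl⟩).trans
    hn₀.le, fun j => hY1 _, fun j i hi => hY0 _ _ (lt_of_lt_of_le hi (hs (Nat.zero_le j))),
    fun i j j' hj hj' => ?_, fun j => hYq _⟩
  by_contra hne
  rcases lt_or_gt_of_ne hne with h | h
  · have := hs (Nat.succ_le_of_lt h)
    have := (hs' hj).2; have := (hs' hj').1; simp only [Nat.succ_eq_add_one] at *; omega
  · have := hs (Nat.succ_le_of_lt h)
    have := (hs' hj').2; have := (hs' hj).1; simp only [Nat.succ_eq_add_one] at *; omega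

theorem exists_linearMap_of_sup_equiv (q : Seminorm ℝ (ℕ →₀ ℝ)) {C : ℝ}
    (hu : ∀ v, q v ≤ ⨆ i, |v i|) (hl : ∀ v, (⨆ i, |v i|) ≤ C * q v) (k : ℕ) :
    ∃ K : ℝ, 0 < K ∧ ∀ θ > 0, ∃ D : PiLp ∞ (fun _ : Fin k => ℝ) →ₗ[ℝ] (ℕ →₀ ℝ),
      ∀ a, |q (D a) - ‖a‖ * K| ≤ ‖a‖ * (3 * θ) := by
  obtain ⟨K, hK, hblock⟩ := exists_blocks_of_sup_equiv q hu hl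
  refine ⟨K, hK, fun θ hθ => ?_⟩
  obtain ⟨n₀, y, hy, hy1, hy0, hdisj, hyq⟩ := hblock θ hθ
  have hcoord : ∀ (a : PiLp ∞ (fun _ : Fin k => ℝ)) j, |a j| ≤ ‖a‖ := fun a j =>
    PiLp.norm_apply_le a j
  let D : PiLp ∞ (fun _ : Fin k => ℝ) →ₗ[ℝ] (ℕ →₀ ℝ) :=
    { toFun := fun a => ∑ j, a j • y j
      map_add' := fun a b => by simp [add_smul, Finset.sum_add_distrib]
      map_smul' := fun c a => by simp [mul_smul, Finset.smul_sum] }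
  have hD : ∀ a, D a = ∑ j, a j • y j := fun _ => rfl
  have hsup : ∀ a i, |D a i| ≤ ‖a‖ := fun a i => by
    rw [hD, Finsupp.finsetSum_apply]
    by_cases h : ∃ j : Fin k, y j i ≠ 0
    · obtain ⟨j, hj⟩ := h
      rw [Finset.sum_eq_single j]
      · rw [Finsupp.smul_apply, smul_eq_mul, abs_mul]
        exact (mul_le_of_le_one_right (abs_nonneg _) (hy1 _ _)).trans (hcoord a j)
      · intro j' _ hne
        by_cases hj' : y j' i = 0
        · simp [hj']
        · exact absurd (Fin.ext (hdisj i _ _ hj' hj)) hne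
      · simp
    · push Not at h
      simp [h]
  have hup : ∀ a, q (D a) ≤ ‖a‖ * (K + θ) := fun a => by
    rcases eq_or_ne a 0 with rfl | ha
    · simp
    have hn : 0 < ‖a‖ := norm_pos_iff.2 ha
    have := hy (‖a‖⁻¹ • D a) (fun i => by
        rw [Finsupp.smul_apply, smul_eq_mul, abs_mul, abs_of_pos (inv_pos.2 hn),
          inv_mul_le_iff₀ hn, mul_one]
        exact hsup a i) (fun i hi => by
        rw [hD, Finsupp.smul_apply, Finsupp.finsetSum_apply]
        simp [hy0 _ i hi])
    rw [map_smul_eq_mul, norm_inv, norm_norm, inv_mul_le_iff₀ hn] at this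
    exact this
  have hlo : ∀ a, ‖a‖ * (K - 3 * θ) ≤ q (D a) := fun a => by
    rcases eq_or_ne a 0 with rfl | ha
    · simp
    obtain ⟨j, hj⟩ : ∃ j, |a j| = ‖a‖ := by
      rw [PiLp.norm_eq_ciSup]
      have : Nonempty (Fin k) := by
        by_contra h
        rw [not_nonempty_iff] at h
        exact ha (Subsingleton.elim _ _)
      exact exists_eq_ciSup_of_finite
    let b : PiLp ∞ (fun _ : Fin k => ℝ) := WithLp.toLp ∞ fun i => if i = j then a j else - a i
    have hb : ‖b‖ ≤ ‖a‖ := by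
      rw [PiLp.norm_eq_ciSup]
      refine Real.iSup_le (fun i => ?_) (norm_nonneg _)
      by_cases h : i = j
      · simpa [b, h] using hcoord a j
      · simpa [b, h] using hcoord a i
    have hsum : D a + D b = (2 * a j) • y j := by
      rw [← map_add, hD, Finset.sum_eq_single j]
      · simp [b, two_mul]
      · intro i _ hi
        simp [b, hi]
      · simp
    have h1 : q ((2 * a j) • y j) ≤ q (D a) + q (D b) := hsum ▸ map_add_le_add q _ _
    rw [map_smul_eq_mul, norm_mul, Real.norm_eq_abs, Real.norm_eq_abs, hj, abs_two] at h1
    have h2 := hup b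
    have h3 : ‖b‖ * (K + θ) ≤ ‖a‖ * (K + θ) := by gcongr
    have h4 := mul_le_mul_of_nonneg_left (hyq j).le (norm_nonneg a)
    linarith
  refine ⟨D, fun a => ?_⟩
  have h1 := hup a
  have h2 := hlo a
  have h3 : 0 ≤ ‖a‖ * θ := by positivity
  rw [abs_le]
  constructor <;> linarith

theorem exists_almost_isometric_linfty (q : Seminorm ℝ (ℕ →₀ ℝ)) {C : ℝ}
    (hu : ∀ v, q v ≤ ⨆ i, |v i|) (hl : ∀ v, (⨆ i, |v i|) ≤ C * q v) (k : ℕ)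
    (Λ : Finset (PiLp ∞ (fun _ : Fin k => ℝ))) (δ : ℝ) (hδ : 0 < δ) :
    ∃ B : PiLp ∞ (fun _ : Fin k => ℝ) →ₗ[ℝ] (ℕ →₀ ℝ), ∀ a ∈ Λ, |q (B a) - ‖a‖| ≤ δ := by
  obtain ⟨K, hK, h⟩ := exists_linearMap_of_sup_equiv q hu hl k
  set R : ℝ := 1 + ∑ a ∈ Λ, ‖a‖ with hR
  have hR0 : 0 < R := add_pos_of_pos_of_nonneg one_pos (Finset.sum_nonneg fun _ _ => norm_nonneg _)
  obtain ⟨D, hD⟩ := h (K * δ / (3 * R)) (by positivity)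
  refine ⟨K⁻¹ • D, fun a ha => ?_⟩
  have haR : ‖a‖ ≤ R := by
    have := Finset.single_le_sum (f := fun a => ‖a‖) (fun _ _ => norm_nonneg _) ha
    linarith
  rw [LinearMap.smul_apply, map_smul_eq_mul, Real.norm_eq_abs, abs_of_pos (inv_pos.2 hK)]
  have : K⁻¹ * q (D a) - ‖a‖ = (q (D a) - ‖a‖ * K) / K := by field_simp
  rw [this, abs_div, abs_of_pos hK, div_le_iff₀ hK]
  calc _ ≤ ‖a‖ * (3 * (K * δ / (3 * R))) := hD a
    _ ≤ R * (3 * (K * δ / (3 * R))) := by gcongr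
    _ = δ * K := by field_simp

end SupNorm

section SpreadingModel

/-- The `p`-th power of the `ℓ_p` norm of a finitely supported family. -/
def powSum {ι : Type*} (p : ℝ) (v : ι →₀ ℝ) : ℝ := v.sum fun _ b => |b| ^ p

theorem powSum_add_single {ι : Type*} {p : ℝ} (hp : 1 ≤ p) {v : ι →₀ ℝ} {n : ι}
    (hn : n ∉ v.support) (a : ℝ) :
    powSum p (v + Finsupp.single n a) = powSum p v + |a| ^ p := by
  have h0 : |(0 : ℝ)| ^ p = 0 := by rw [abs_zero, Real.zero_rpow (by linarith)]
  rw [powSum, Finsupp.sum_add_index_of_disjoint, Finsupp.sum_single_index h0, powSum]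
  rw [Finset.disjoint_left]
  intro i hi hi'
  rw [Finset.mem_singleton.1 (Finsupp.support_single_subset hi')] at hi
  exact hn hi

/-- `Φ` is a limit of values `q (∑ aᵢ eₙᵢ)` over disjoint blocks of the unit vector basis: its
values along a linear family of coefficient lists are approximated on finite sets by `q ∘ B` for
linear maps `B` which preserve the `ℓ_p` norm. -/
def Realizes (q : Seminorm ℝ (ℕ →₀ ℝ)) (p : ℝ) (Φ : List ℝ → ℝ) : Prop :=
  ∀ (V : Type) [AddCommGroup V] [Module ℝ V] (l : List (V →ₗ[ℝ] ℝ)) (Λ : Finset V) (δ : ℝ),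
    0 < δ → ∃ B : V →ₗ[ℝ] (ℕ →₀ ℝ), (∀ a, powSum p (B a) = (l.map fun g => |g a| ^ p).sum) ∧
      ∀ a ∈ Λ, |q (B a) - Φ (l.map fun g => g a)| ≤ δ

theorem Realizes.of_tendsto {q : Seminorm ℝ (ℕ →₀ ℝ)} {p : ℝ} {Φ : ℕ → List ℝ → ℝ}
    {Ψ : List ℝ → ℝ} (h : ∀ m, Realizes q p (Φ m))
    (hΨ : ∀ l, Tendsto (fun m => Φ m l) (hyperfilter ℕ) (𝓝 (Ψ l))) : Realizes q p Ψ := by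
  intro V _ _ l Λ δ hδ
  have hev : ∀ᶠ m in hyperfilter ℕ, ∀ a ∈ Λ,
      |Φ m (l.map fun g => g a) - Ψ (l.map fun g => g a)| ≤ δ / 2 := by
    rw [eventually_all_finset]
    intro a _
    filter_upwards [Metric.tendsto_nhds.1 (hΨ (l.map fun g => g a)) (δ / 2) (by positivity)]
      with m hm using (Real.dist_eq _ _ ▸ hm).le
  obtain ⟨m, hm⟩ := hev.exists
  obtain ⟨B, hB1, hB2⟩ := h m V l Λ (δ / 2) (by positivity)
  refine ⟨B, hB1, fun a ha => (abs_sub_le _ (Φ m (l.map fun g => g a)) _).trans ?_⟩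
  linarith [hm a ha, hB2 a ha]

namespace Realizes

variable {q : Seminorm ℝ (ℕ →₀ ℝ)} {p : ℝ} {Φ : List ℝ → ℝ}

theorem map_add_le (h : Realizes q p Φ) {ι : Type*} (l : List ι) (x y : ι → ℝ) :
    Φ (l.map fun i => x i + y i) ≤ Φ (l.map x) + Φ (l.map y) := by
  refine le_of_forall_pos_le_add fun δ hδ => ?_
  obtain ⟨B, -, hB⟩ := h (ℝ × ℝ)
    (l.map fun i => x i • LinearMap.fst ℝ ℝ ℝ + y i • LinearMap.snd ℝ ℝ ℝ)
    {(1, 0), (0, 1), (1, 1)} (δ / 3) (by positivity)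
  have h1 := abs_le.1 (hB (1, 0) (by simp))
  have h2 := abs_le.1 (hB (0, 1) (by simp))
  have h3 := abs_le.1 (hB (1, 1) (by simp))
  have h4 : q (B (1, 1)) ≤ q (B (1, 0)) + q (B (0, 1)) := by
    rw [show ((1, 1) : ℝ × ℝ) = (1, 0) + (0, 1) by simp, map_add]
    exact map_add_le_add q _ _
  simp only [List.map_map, Function.comp_def, LinearMap.add_apply, LinearMap.smul_apply,
    LinearMap.fst_apply, LinearMap.snd_apply, smul_eq_mul, mul_one, mul_zero, add_zero,
    zero_add] at h1 h2 h3
  linarith [h1.2, h2.2, h3.1]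

theorem map_mul (h : Realizes q p Φ) {ι : Type*} (l : List ι) (c : ℝ) (x : ι → ℝ) :
    Φ (l.map fun i => c * x i) = |c| * Φ (l.map x) := by
  refine eq_of_abs_sub_le_all fun δ hδ => ?_
  obtain ⟨B, -, hB⟩ := h ℝ (l.map fun i => x i • LinearMap.id) {1, c} (δ / (1 + |c|))
    (by positivity)
  have h1 := hB 1 (by simp)
  have h2 := hB c (by simp)
  have h3 : q (B c) = |c| * q (B 1) := by
    rw [← Real.norm_eq_abs, ← map_smul_eq_mul, ← map_smul, smul_eq_mul, mul_one]
  simp only [List.map_map, Function.comp_def, LinearMap.smul_apply, LinearMap.id_apply,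
    smul_eq_mul, mul_one] at h1 h2
  simp only [mul_comm (x _) c, h3] at h2
  rw [abs_sub_comm] at h2
  have h4 : |(|c| * q (B 1) - |c| * Φ (l.map x))| ≤ |c| * (δ / (1 + |c|)) := by
    rw [← mul_sub, abs_mul, abs_abs]; gcongr
  refine (abs_sub_le _ _ _).trans ((add_le_add h2 h4).trans_eq ?_)
  field_simp

theorem le_rpow_sum (h : Realizes q p Φ) (hu : ∀ v, q v ≤ powSum p v ^ (1 / p)) (l : List ℝ) :
    Φ l ≤ (l.map fun b => |b| ^ p).sum ^ (1 / p) := by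
  refine le_of_forall_pos_le_add fun δ hδ => ?_
  obtain ⟨B, hB, hB'⟩ := h ℝ (l.map fun b => b • LinearMap.id) {1} δ hδ
  have h1 := (abs_le.1 (hB' 1 (by simp))).1
  have h2 := hu (B 1)
  rw [hB] at h2
  simp only [List.map_map, Function.comp_def, LinearMap.smul_apply, LinearMap.id_apply,
    smul_eq_mul, mul_one, List.map_id'] at h1 h2
  linarith

theorem rpow_sum_le (h : Realizes q p Φ) {C : ℝ} (hC : 0 < C)
    (hl : ∀ v, powSum p v ^ (1 / p) ≤ C * q v) (l : List ℝ) :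
    (l.map fun b => |b| ^ p).sum ^ (1 / p) ≤ C * Φ l := by
  refine le_of_forall_pos_le_add fun δ hδ => ?_
  obtain ⟨B, hB, hB'⟩ := h ℝ (l.map fun b => b • LinearMap.id) {1} (δ / C) (by positivity)
  have h1 := (abs_le.1 (hB' 1 (by simp))).2
  have h2 := hl (B 1)
  rw [hB] at h2
  simp only [List.map_map, Function.comp_def, LinearMap.smul_apply, LinearMap.id_apply,
    smul_eq_mul, mul_one, List.map_id'] at h1 h2
  have h3 : C * (q (B 1) - Φ l) ≤ C * (δ / C) := by gcongr
  rw [mul_div_cancel₀ _ hC.ne'] at h3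
  linarith

/-- Changing one entry of the list changes the value by at most the size of the change. -/
theorem abs_sub_le_of_replace (h : Realizes q p Φ) (hp : 1 ≤ p)
    (hu : ∀ v, q v ≤ powSum p v ^ (1 / p)) (l₁ l₂ : List ℝ) (a b : ℝ) :
    |Φ (l₁ ++ a :: l₂) - Φ (l₁ ++ b :: l₂)| ≤ |a - b| := by
  have key : ∀ a b, Φ (l₁ ++ a :: l₂) ≤ Φ (l₁ ++ b :: l₂) + |a - b| := fun a b => by
    let l : List (ℝ × ℝ) := l₁.map (fun c => (c, 0)) ++ (b, a - b) :: l₂.map (fun c => (c, 0))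
    have h1 := h.map_add_le l Prod.fst Prod.snd
    have h2 := h.le_rpow_sum hu (l.map Prod.snd)
    have hp0 : p ≠ 0 := by linarith
    simp only [l, List.map_append, List.map_map, Function.comp_def, List.map_cons, add_zero,
      add_sub_cancel, List.map_id', List.sum_append, List.sum_cons, abs_zero,
      Real.zero_rpow hp0, List.map_const', List.map_replicate, List.sum_replicate, smul_zero,
      zero_add] at h1 h2
    rw [one_div, Real.rpow_rpow_inv (abs_nonneg _) hp0] at h2
    linarith
  rw [abs_le]
  constructor
  · have := key b a
    rw [abs_sub_comm] at this
    linarith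
  · linarith [key a b]

end Realizes

/-- The iterated limit of `q (v + ∑ aᵢ eₙᵢ)` as `n₁, n₂, …` tend to infinity along a fixed
ultrafilter, the last index first. -/
def iterLim (q : Seminorm ℝ (ℕ →₀ ℝ)) : List ℝ → (ℕ →₀ ℝ) → ℝ
  | [], v => q v
  | a :: l, v => ultralim fun n => iterLim q l (v + Finsupp.single n a)

variable {q : Seminorm ℝ (ℕ →₀ ℝ)} {p : ℝ}

theorem le_abs_of_le_powSum (hp : 1 ≤ p) (hu : ∀ v, q v ≤ powSum p v ^ (1 / p)) (n : ℕ) (a : ℝ) :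
    q (Finsupp.single n a) ≤ |a| := by
  have hp0 : p ≠ 0 := by linarith
  have := hu (Finsupp.single n a)
  rwa [powSum, Finsupp.sum_single_index (by simp [hp0]), one_div,
    Real.rpow_rpow_inv (abs_nonneg _) hp0] at this

theorem abs_iterLim_le (hq : ∀ n a, q (Finsupp.single n a) ≤ |a|) (l : List ℝ) (v : ℕ →₀ ℝ) :
    |iterLim q l v| ≤ q v + (l.map abs).sum := by
  induction l generalizing v with
  | nil => simp [iterLim, abs_of_nonneg (apply_nonneg q v)]
  | cons a l ih =>
    have hb : ∀ n, |iterLim q l (v + Finsupp.single n a)| ≤ q v + ((a :: l).map abs).sum :=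
      fun n => (ih _).trans (by
        rw [List.map_cons, List.sum_cons]
        linarith [map_add_le_add q v (Finsupp.single n a), hq n a])
    exact le_of_tendsto (tendsto_ultralim (Eventually.of_forall hb)).abs (Eventually.of_forall hb)

theorem tendsto_iterLim (hq : ∀ n a, q (Finsupp.single n a) ≤ |a|) (a : ℝ) (l : List ℝ)
    (v : ℕ →₀ ℝ) :
    Tendsto (fun n => iterLim q l (v + Finsupp.single n a)) (hyperfilter ℕ)
      (𝓝 (iterLim q (a :: l) v)) :=
  tendsto_ultralim (K := q v + |a| + (l.map abs).sum) <| Eventually.of_forall fun n =>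
    (abs_iterLim_le hq _ _).trans (by
      linarith [map_add_le_add q v (Finsupp.single n a), hq n a])

theorem iterLim_insert_zero (l₁ l₂ : List ℝ) (v : ℕ →₀ ℝ) :
    iterLim q (l₁ ++ 0 :: l₂) v = iterLim q (l₁ ++ l₂) v := by
  induction l₁ generalizing v with
  | nil => simp [iterLim, ultralim_const]
  | cons a l ih => simp only [List.cons_append, iterLim, ih]

theorem exists_linearMap_iterLim (hp : 1 ≤ p) (hq : ∀ n a, q (Finsupp.single n a) ≤ |a|)
    {V : Type*} [AddCommGroup V] [Module ℝ V] (l : List (V →ₗ[ℝ] ℝ)) (Λ : Finset V) (δ : ℝ)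
    (hδ : 0 < δ) (D : V →ₗ[ℝ] (ℕ →₀ ℝ)) (S : Finset ℕ) (hS : ∀ a, (D a).support ⊆ S) :
    ∃ B : V →ₗ[ℝ] (ℕ →₀ ℝ),
      (∀ a, powSum p (B a) = powSum p (D a) + (l.map fun g => |g a| ^ p).sum) ∧
      ∀ a ∈ Λ, |q (B a) - iterLim q (l.map fun g => g a) (D a)| ≤ δ := by
  induction l generalizing D S δ with
  | nil => exact ⟨D, by simp, by simp [iterLim, hδ.le]⟩
  | cons g l ih =>
    have hev : ∀ᶠ n in hyperfilter ℕ, ∀ a ∈ Λ,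
        |iterLim q (l.map fun g => g a) (D a + Finsupp.single n (g a)) -
          iterLim q (g a :: l.map fun g => g a) (D a)| ≤ δ / 2 := by
      rw [eventually_all_finset]
      intro a _
      filter_upwards [Metric.tendsto_nhds.1 (tendsto_iterLim hq (g a) (l.map fun g => g a) (D a))
        (δ / 2) (by positivity)] with n hn using (Real.dist_eq _ _ ▸ hn).le
    obtain ⟨n, hn, hnS⟩ := (hev.and (S.finite_toSet.compl_mem_hyperfilter)).exists
    have hnS' : n ∉ S := by simpa using hnS
    obtain ⟨B, hB, hB'⟩ := ih (δ / 2) (by positivity) (D + Finsupp.lsingle n ∘ₗ g) (insert n S)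
      (fun a i hi => by
        rcases Finset.mem_union.1 (Finsupp.support_add hi) with h | h
        · exact Finset.mem_insert_of_mem (hS a h)
        · rw [Finset.mem_singleton.1 (Finsupp.support_single_subset h)]
          exact Finset.mem_insert_self _ _)
    have hDa : ∀ a, (D + Finsupp.lsingle n ∘ₗ g) a = D a + Finsupp.single n (g a) :=
      fun a => rfl
    refine ⟨B, fun a => ?_, fun a ha => ?_⟩
    · rw [hB, hDa, powSum_add_single hp (fun h => hnS' (hS a h)), List.map_cons, List.sum_cons,
        add_assoc]
    · have h1 := hB' a ha
      rw [hDa] at h1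
      refine (abs_sub_le _ _ _).trans ((add_le_add h1 (hn a ha)).trans_eq (add_halves δ))

theorem realizes_iterLim (hp : 1 ≤ p) (hq : ∀ n a, q (Finsupp.single n a) ≤ |a|) :
    Realizes q p fun l => iterLim q l 0 := fun V _ _ l Λ δ hδ => by
  simpa [powSum] using exists_linearMap_iterLim hp hq l Λ δ hδ 0 ∅ (by simp)

/-- The list `b, -b, b, -b, …` of length `2 * n`. -/
def alternating {M : Type*} [Neg M] (n : ℕ) (b : M) : List M := (List.replicate n [b, -b]).flatten

theorem alternating_append_singleton {M : Type*} [InvolutiveNeg M] (n : ℕ) (b : M) :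
    alternating n b ++ [b] = b :: alternating n (-b) := by
  induction n with
  | zero => simp [alternating]
  | succ n ih =>
    simp only [alternating, neg_neg] at ih
    simp only [alternating, List.replicate_succ, List.flatten_cons, neg_neg]
    rw [List.append_assoc, ih]
    simp

theorem alternating_zero {M : Type*} [SubtractionMonoid M] (n : ℕ) :
    alternating n (0 : M) = List.replicate (n * 2) 0 := by
  rw [alternating, neg_zero]
  exact List.flatten_replicate_replicate (m := 2)

theorem map_alternating {M N : Type*} [AddGroup M] [AddGroup N] (f : M → N)
    (hf : ∀ a, f (-a) = -f a) (n : ℕ) (b : M) :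
    (alternating n b).map f = alternating n (f b) := by
  simp [alternating, hf]

/-- The scaling factor which makes `alternating (m + 1)` preserve the `ℓ_p` norm. -/
def altScale (p : ℝ) (m : ℕ) : ℝ := (2 * (m + 1) : ℝ) ^ (-(1 / p))

theorem altScale_nonneg (p : ℝ) (m : ℕ) : 0 ≤ altScale p m := by unfold altScale; positivity

theorem tendsto_altScale (hp : 1 ≤ p) : Tendsto (altScale p) atTop (𝓝 0) := by
  have : 0 < 1 / p := by positivity
  refine (tendsto_rpow_neg_atTop this).comp ?_
  exact (tendsto_natCast_atTop_atTop.atTop_add tendsto_const_nhds).const_mul_atTop two_pos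

theorem sum_alternating_rpow (hp : 1 ≤ p) (m : ℕ) (b : ℝ) :
    ((alternating (m + 1) (altScale p m * b)).map fun b => |b| ^ p).sum = |b| ^ p := by
  have h1 : altScale p m ^ p = (2 * (m + 1) : ℝ)⁻¹ := by
    rw [altScale, ← Real.rpow_mul (by positivity), neg_mul, one_div,
      inv_mul_cancel₀ (by linarith), Real.rpow_neg_one]
  simp only [alternating, List.map_flatten, List.sum_flatten, List.map_replicate, List.map_cons,
    List.map_nil, List.sum_cons, List.sum_nil, abs_neg, List.sum_replicate, abs_mul,
    abs_of_nonneg (altScale_nonneg p m)]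
  rw [nsmul_eq_mul, Real.mul_rpow (altScale_nonneg p m) (abs_nonneg _), h1]
  push_cast
  field_simp
  ring

/-- Replace each entry of a list by a normalized alternating block. -/
def alternate (p : ℝ) (m : ℕ) (l : List ℝ) : List ℝ :=
  l.flatMap fun a => alternating (m + 1) (altScale p m * a)

theorem Realizes.comp_alternate {Φ : List ℝ → ℝ} (h : Realizes q p Φ) (hp : 1 ≤ p) (m : ℕ) :
    Realizes q p fun l => Φ (alternate p m l) := by
  intro V _ _ l Λ δ hδ
  obtain ⟨B, hB, hB'⟩ := h V (l.flatMap fun g => alternating (m + 1) (altScale p m • g)) Λ δ hδ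
  have hmap : ∀ a : V, (l.flatMap fun g => alternating (m + 1) (altScale p m • g)).map
      (fun g => g a) = alternate p m (l.map fun g => g a) := fun a => by
    simp only [alternate, List.map_flatMap, List.flatMap_map]
    congr 1
    ext1 g
    exact map_alternating (fun g : V →ₗ[ℝ] ℝ => g a) (fun g => rfl) _ _
  have hsum : ∀ l : List ℝ, ((alternate p m l).map fun b => |b| ^ p).sum =
      (l.map fun b => |b| ^ p).sum := fun l => by
    induction l with
    | nil => rfl
    | cons a l ih =>
      rw [alternate, List.flatMap_cons, List.map_append, List.sum_append,
        sum_alternating_rpow hp, List.map_cons, List.sum_cons]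
      exact congrArg _ ih
  refine ⟨B, fun a => ?_, fun a ha => ?_⟩
  · have h := hsum (l.map fun g => g a)
    rw [← hmap, List.map_map, List.map_map] at h
    rw [hB]
    exact h
  · have h := hB' a ha
    rwa [hmap] at h

theorem insert_replicate_zero {Φ : List ℝ → ℝ}
    (h0 : ∀ l₁ l₂, Φ (l₁ ++ 0 :: l₂) = Φ (l₁ ++ l₂)) (n : ℕ) (l₁ l₂ : List ℝ) :
    Φ (l₁ ++ (List.replicate n 0 ++ l₂)) = Φ (l₁ ++ l₂) := by
  induction n with
  | zero => rfl
  | succ n ih => rw [List.replicate_succ, List.cons_append, h0, ih]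

theorem alternate_append (p : ℝ) (m : ℕ) (l₁ l₂ : List ℝ) (a : ℝ) :
    alternate p m (l₁ ++ a :: l₂) = alternate p m l₁ ++
      (alternating (m + 1) (altScale p m * a) ++ alternate p m l₂) := by
  simp [alternate]

theorem Realizes.abs_alternate_neg_le {Φ : List ℝ → ℝ} (h : Realizes q p Φ) (hp : 1 ≤ p)
    (hu : ∀ v, q v ≤ powSum p v ^ (1 / p)) (h0 : ∀ l₁ l₂, Φ (l₁ ++ 0 :: l₂) = Φ (l₁ ++ l₂))
    (m : ℕ) (l₁ l₂ : List ℝ) (a : ℝ) :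
    |Φ (alternate p m (l₁ ++ a :: l₂)) - Φ (alternate p m (l₁ ++ (-a) :: l₂))| ≤
      altScale p m * (2 * |a|) := by
  rw [alternate_append, alternate_append]
  set b := altScale p m * a with hb
  have hb' : altScale p m * -a = -b := by rw [hb]; ring
  rw [hb']
  set A := alternate p m l₁
  set Z := alternate p m l₂
  have h1 := h.abs_sub_le_of_replace hp hu (A ++ alternating (m + 1) b) Z 0 b
  have h2 := h.abs_sub_le_of_replace hp hu A (alternating (m + 1) (-b) ++ Z) b 0
  rw [h0, List.append_assoc] at h1
  rw [h0] at h2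
  have h3 : A ++ alternating (m + 1) b ++ b :: Z = A ++ b :: (alternating (m + 1) (-b) ++ Z) := by
    rw [← List.cons_append, ← alternating_append_singleton]
    simp
  rw [h3] at h1
  refine (abs_sub_le _ _ _).trans ((add_le_add h1 h2).trans_eq ?_)
  rw [zero_sub, abs_neg, sub_zero, hb, abs_mul, abs_of_nonneg (altScale_nonneg p m)]
  ring

/-- A seminorm equivalent to the `ℓ_p` norm has a spreading model, on blocks, that is
invariant under changes of signs. -/
theorem exists_realizes_symmetric (hp : 1 ≤ p) {C : ℝ} (hC : 0 < C)
    (hu : ∀ v, q v ≤ powSum p v ^ (1 / p)) (hl : ∀ v, powSum p v ^ (1 / p) ≤ C * q v) :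
    ∃ Φ : List ℝ → ℝ, Realizes q p Φ ∧ (∀ l₁ l₂, Φ (l₁ ++ 0 :: l₂) = Φ (l₁ ++ l₂)) ∧
      ∀ l₁ l₂ a, Φ (l₁ ++ (-a) :: l₂) = Φ (l₁ ++ a :: l₂) := by
  have hR := realizes_iterLim hp (le_abs_of_le_powSum hp hu)
  have hZ : ∀ l₁ l₂, iterLim q (l₁ ++ 0 :: l₂) 0 = iterLim q (l₁ ++ l₂) 0 := fun l₁ l₂ =>
    iterLim_insert_zero l₁ l₂ 0
  have hRm := fun m => hR.comp_alternate hp m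
  have hbd : ∀ l m, |iterLim q (alternate p m l) 0| ≤ (l.map fun b => |b| ^ p).sum ^ (1 / p) :=
    fun l m => by
      have h1 := (hRm m).le_rpow_sum hu l
      have h2 := (hRm m).rpow_sum_le hC hl l
      have h3 : 0 ≤ (l.map fun b => |b| ^ p).sum ^ (1 / p) :=
        Real.rpow_nonneg (List.sum_nonneg (by
          simp only [List.mem_map]; rintro _ ⟨b, -, rfl⟩; positivity)) _
      rwa [abs_of_nonneg (nonneg_of_mul_nonneg_right (h3.trans h2) hC)]
  have ht : ∀ l, Tendsto (fun m => iterLim q (alternate p m l) 0) (hyperfilter ℕ)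
      (𝓝 (ultralim fun m => iterLim q (alternate p m l) 0)) := fun l =>
    tendsto_ultralim (Eventually.of_forall (hbd l))
  refine ⟨fun l => ultralim fun m => iterLim q (alternate p m l) 0, .of_tendsto hRm ht,
    fun l₁ l₂ => ?_, fun l₁ l₂ a => ?_⟩
  · simp only [alternate_append, mul_zero, alternating_zero,
      insert_replicate_zero (Φ := fun l => iterLim q l 0) hZ]
    simp [alternate]
  · have h1 : Tendsto (fun m => iterLim q (alternate p m (l₁ ++ a :: l₂)) 0 -
        iterLim q (alternate p m (l₁ ++ (-a) :: l₂)) 0) (hyperfilter ℕ) (𝓝 0) := by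
      refine squeeze_zero_norm (fun m => hR.abs_alternate_neg_le hp hu hZ m l₁ l₂ a) ?_
      simpa using ((tendsto_altScale hp).mono_left Nat.hyperfilter_le_atTop).mul_const (2 * |a|)
    exact (sub_eq_zero.1 (tendsto_nhds_unique ((ht _).sub (ht _)) h1)).symm

end SpreadingModel

section Words

/-- The list of nonzero values of a finitely supported function on `ℝ`, from left to right. -/
def word (x : ℝ →₀ ℝ) : List ℝ := x.support.sort.map x

theorem Finset.sort_eq_of_sortedLT {α : Type*} [LinearOrder α] {s : Finset α} {l : List α}
    (hl : l.Pairwise (· < ·)) (h : ∀ a, a ∈ l ↔ a ∈ s) : s.sort = l :=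
  List.Pairwise.eq_of_mem_iff s.sortedLT_sort.pairwise hl fun a => by simp [h]

theorem word_mapDomain {f : ℝ → ℝ} (hf : StrictMono f) (x : ℝ →₀ ℝ) :
    word (x.mapDomain f) = word x := by
  classical
  have h : (x.mapDomain f).support.sort = x.support.sort.map f :=
    Finset.sort_eq_of_sortedLT
      (List.pairwise_map.2 (x.support.sortedLT_sort.pairwise.imp fun h => hf h)) fun a => by
        simp [Finsupp.mapDomain_support_of_injective hf.injective]
  rw [word, h, List.map_map, word]
  congr 1
  ext t
  exact Finsupp.mapDomain_apply hf.injective _ _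

theorem word_add {x y : ℝ →₀ ℝ} (h : ∀ s ∈ x.support, ∀ t ∈ y.support, s < t) :
    word (x + y) = word x ++ word y := by
  classical
  have hd : Disjoint x.support y.support :=
    Finset.disjoint_left.2 fun s hs ht => (h s hs s ht).false
  have hs : (x + y).support.sort = x.support.sort ++ y.support.sort :=
    Finset.sort_eq_of_sortedLT (List.pairwise_append.2 ⟨x.support.sortedLT_sort.pairwise,
      y.support.sortedLT_sort.pairwise, fun s hs t ht => h s (by simpa using hs) t
        (by simpa using ht)⟩) fun a => by simp [Finsupp.support_add_eq hd]
  rw [word, hs, List.map_append, word, word]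
  congr 1 <;> refine List.map_congr_left fun t ht => ?_
  · have : t ∉ y.support := Finset.disjoint_left.1 hd ((Finset.mem_sort _).1 ht)
    simp [Finsupp.notMem_support_iff.1 this]
  · have : t ∉ x.support := Finset.disjoint_right.1 hd ((Finset.mem_sort _).1 ht)
    simp [Finsupp.notMem_support_iff.1 this]

theorem word_sum_range {w : ℕ → List ℝ} {z : ℕ → ℝ →₀ ℝ} (n : ℕ) (hw : ∀ i < n, word (z i) = w i)
    (h : ∀ i j, i < j → j < n → ∀ s ∈ (z i).support, ∀ t ∈ (z j).support, s < t) :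
    word (∑ i ∈ Finset.range n, z i) = (List.range n).flatMap w := by
  classical
  induction n with
  | zero => simp [word]
  | succ n ih =>
    rw [Finset.sum_range_succ, word_add, ih (fun i hi => hw i (by omega))
      fun i j hij hj => h i j hij (by omega), List.range_succ, List.flatMap_append, hw n (by omega)]
    · simp
    · intro s hs t ht
      obtain ⟨i, hi, hs'⟩ := Finset.mem_biUnion.1 (Finsupp.support_finsetSum hs)
      exact h i n (Finset.mem_range.1 hi) (by omega) s hs' t ht

theorem flatMap_range_replicate (w : List ℝ) (r : ℕ → ℕ) (k : ℕ) :
    (List.range k).flatMap (fun i => (List.replicate (r i) w).flatten) =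
      (List.replicate (∑ i ∈ Finset.range k, r i) w).flatten := by
  induction k with
  | zero => simp
  | succ k ih =>
    rw [List.range_succ, List.flatMap_append, ih, Finset.sum_range_succ,
      ← List.replicate_append_replicate, List.flatten_append]
    simp

theorem flatMap_range_const (w : List ℝ) (k : ℕ) :
    (List.range k).flatMap (fun _ => w) = (List.replicate k w).flatten := by
  simpa using flatMap_range_replicate w (fun _ => 1) k

/-- Translation of functions on `ℝ` by `i`. -/
def shift (i : ℕ) : (ℝ →₀ ℝ) →ₗ[ℝ] (ℝ →₀ ℝ) := Finsupp.lmapDomain ℝ ℝ fun t => t + i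

/-- Concatenation of `r` consecutive copies, compressed so that functions supported in `(0, 1)`
are mapped to such functions. -/
def concat (r : ℕ) : (ℝ →₀ ℝ) →ₗ[ℝ] (ℝ →₀ ℝ) :=
  ∑ j ∈ Finset.range r, Finsupp.lmapDomain ℝ ℝ fun t => (t + j) / r

theorem concat_apply (r : ℕ) (x : ℝ →₀ ℝ) :
    concat r x = ∑ j ∈ Finset.range r, x.mapDomain fun t : ℝ => (t + j) / r := by
  simp [concat]

theorem mem_support_mapDomain {f : ℝ → ℝ} {x : ℝ →₀ ℝ} {s : ℝ}
    (hs : s ∈ (x.mapDomain f).support) : ∃ t ∈ x.support, f t = s := by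
  classical
  simpa using Finsupp.mapDomain_support hs

theorem word_shift (i : ℕ) (x : ℝ →₀ ℝ) : word (shift i x) = word x :=
  word_mapDomain (fun _ _ h => by simpa using h) x

variable {u : ℝ →₀ ℝ}

theorem shift_lt_shift (v : ℝ →₀ ℝ) (hu : ∀ t ∈ u.support, t ∈ Set.Ioo 0 1)
    (hv : ∀ t ∈ v.support, t ∈ Set.Ioo 0 1) {i j : ℕ}
    (hij : i < j) : ∀ s ∈ (shift i u).support, ∀ t ∈ (shift j v).support, s < t := by
  intro s hs t ht
  obtain ⟨s', hs', rfl⟩ := mem_support_mapDomain hs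
  obtain ⟨t', ht', rfl⟩ := mem_support_mapDomain ht
  have h : (i : ℝ) + 1 ≤ j := by exact_mod_cast hij
  have h1 := (hu s' hs').2
  have h2 := (hv t' ht').1
  linarith

theorem word_concat (hu : ∀ t ∈ u.support, t ∈ Set.Ioo 0 1) (r : ℕ) :
    word (concat r u) = (List.replicate r (word u)).flatten := by
  rw [concat_apply, ← flatMap_range_const]
  refine word_sum_range r (fun i hi => ?_) fun i j hij hj s hs t ht => ?_
  · have : (0 : ℝ) < r := by exact_mod_cast (by omega : 0 < r)
    exact word_mapDomain (fun a b h => by gcongr) u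
  · have : (0 : ℝ) < r := by exact_mod_cast (by omega : 0 < r)
    obtain ⟨s', hs', rfl⟩ := mem_support_mapDomain hs
    obtain ⟨t', ht', rfl⟩ := mem_support_mapDomain ht
    have h : (i : ℝ) + 1 ≤ j := by exact_mod_cast hij
    have h1 := (hu s' hs').2
    have h2 := (hu t' ht').1
    exact div_lt_div_of_pos_right (by linarith) this

theorem support_concat (hu : ∀ t ∈ u.support, t ∈ Set.Ioo (0 : ℝ) 1) (r : ℕ) :
    ∀ t ∈ (concat r u).support, t ∈ Set.Ioo (0 : ℝ) 1 := by
  classical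
  intro t ht
  rw [concat_apply] at ht
  obtain ⟨i, hi, ht⟩ := Finset.mem_biUnion.1 (Finsupp.support_finsetSum ht)
  obtain ⟨t', ht', rfl⟩ := mem_support_mapDomain ht
  have hi := Finset.mem_range.1 hi
  have hr : (0 : ℝ) < r := by exact_mod_cast (by omega : 0 < r)
  have hir : (i : ℝ) + 1 ≤ r := by exact_mod_cast hi
  obtain ⟨h1, h2⟩ := hu t' ht'
  exact ⟨by positivity, by rw [div_lt_one hr]; linarith⟩

/-- Concatenations inside consecutive unit intervals and a single concatenation have the same
word. -/
theorem word_sum_shift_concat (hu : ∀ t ∈ u.support, t ∈ Set.Ioo 0 1) (r : ℕ → ℕ) (k : ℕ) :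
    word (∑ i ∈ Finset.range k, shift i (concat (r i) u)) =
      word (concat (∑ i ∈ Finset.range k, r i) u) := by
  rw [word_concat hu, ← flatMap_range_replicate]
  refine word_sum_range k (fun i _ => by rw [word_shift, word_concat hu]) fun i j hij _ =>
    shift_lt_shift _ (support_concat hu _) (support_concat hu _) hij

theorem abs_sum_smul_shift_apply (hu : ∀ t ∈ u.support, t ∈ Set.Ioo 0 1) (a : ℕ → ℝ) (k : ℕ)
    (t : ℝ) : |(∑ i ∈ Finset.range k, a i • shift i u) t| =
      |(∑ i ∈ Finset.range k, |a i| • shift i u) t| := by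
  simp only [Finsupp.finsetSum_apply, Finsupp.smul_apply, smul_eq_mul]
  by_cases h : ∃ i ∈ Finset.range k, shift i u t ≠ 0
  · obtain ⟨i, hi, hit⟩ := h
    have h0 : ∀ j ∈ Finset.range k, j ≠ i → shift j u t = 0 := fun j _ hji => by
      by_contra hj
      rcases lt_or_gt_of_ne hji with hlt | hlt
      · exact (shift_lt_shift u hu hu hlt t (Finsupp.mem_support_iff.2 hj) t
          (Finsupp.mem_support_iff.2 hit)).false
      · exact (shift_lt_shift u hu hu hlt t (Finsupp.mem_support_iff.2 hit) t
          (Finsupp.mem_support_iff.2 hj)).false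
    rw [Finset.sum_eq_single_of_mem i hi fun j hj hji => by rw [h0 j hj hji, mul_zero],
      Finset.sum_eq_single_of_mem i hi fun j hj hji => by rw [h0 j hj hji, mul_zero]]
    simp [abs_mul]
  · push Not at h
    rw [Finset.sum_eq_zero fun i hi => by rw [h i hi, mul_zero],
      Finset.sum_eq_zero fun i hi => by rw [h i hi, mul_zero]]

theorem apply_map_eq_of_abs_eq {Φ : List ℝ → ℝ}
    (hs : ∀ l₁ l₂ a, Φ (l₁ ++ (-a) :: l₂) = Φ (l₁ ++ a :: l₂)) {ι : Type*} {x y : ι → ℝ}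
    (h : ∀ i, |x i| = |y i|) (l : List ι) (l₁ : List ℝ) :
    Φ (l₁ ++ l.map x) = Φ (l₁ ++ l.map y) := by
  induction l generalizing l₁ with
  | nil => rfl
  | cons i l ih =>
    have h1 : Φ (l₁ ++ (i :: l).map x) = Φ (l₁ ++ y i :: l.map x) := by
      rcases abs_eq_abs.1 (h i) with h | h
      · rw [List.map_cons, h]
      · rw [List.map_cons, h, hs]
    rw [h1]
    simpa using ih (l₁ ++ [y i])

theorem apply_map_filter {Φ : List ℝ → ℝ} (h0 : ∀ l₁ l₂, Φ (l₁ ++ 0 :: l₂) = Φ (l₁ ++ l₂))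
    {ι : Type*} (x : ι → ℝ) (l : List ι) (l₁ : List ℝ) :
    Φ (l₁ ++ l.map x) = Φ (l₁ ++ (l.filter (x · ≠ 0)).map x) := by
  induction l generalizing l₁ with
  | nil => rfl
  | cons i l ih =>
    by_cases h : x i = 0
    · simpa [h, h0] using ih l₁
    · simpa [h] using ih (l₁ ++ [x i])

theorem apply_map_sort {Φ : List ℝ → ℝ} (h0 : ∀ l₁ l₂, Φ (l₁ ++ 0 :: l₂) = Φ (l₁ ++ l₂))
    {x : ℝ →₀ ℝ} {S : Finset ℝ} (hS : x.support ⊆ S) : Φ (S.sort.map x) = Φ (word x) := by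
  have h := apply_map_filter h0 x S.sort []
  rw [List.nil_append, List.nil_append] at h
  have hx : x.support.sort = S.sort.filter (x · ≠ 0) :=
    Finset.sort_eq_of_sortedLT (S.sortedLT_sort.pairwise.filter _) fun a => by
      simpa using @hS a
  rw [h, word, hx]

theorem sum_map_word (p : ℝ) (x : ℝ →₀ ℝ) :
    ((word x).map fun b => |b| ^ p).sum = powSum p x := by
  rw [word, List.map_map, powSum, Finsupp.sum, Finset.sum,
    ← Finset.sort_eq x.support (· ≤ ·), Multiset.map_coe, Multiset.sum_coe]
  rfl

/-- The seminorm on `ℝ →₀ ℝ` induced by a functional on lists of coefficients. -/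
def spreadSeminorm {q : Seminorm ℝ (ℕ →₀ ℝ)} {p : ℝ} {Φ : List ℝ → ℝ} (hΦ : Realizes q p Φ)
    (h0 : ∀ l₁ l₂, Φ (l₁ ++ 0 :: l₂) = Φ (l₁ ++ l₂)) : Seminorm ℝ (ℝ →₀ ℝ) :=
  Seminorm.of (fun x => Φ (word x))
    (fun x y => by
      classical
      rw [← apply_map_sort h0 (Finset.subset_union_left (s₁ := x.support) (s₂ := y.support)),
        ← apply_map_sort h0 (Finset.subset_union_right (s₁ := x.support) (s₂ := y.support)),
        ← apply_map_sort h0 (Finsupp.support_add (g₁ := x) (g₂ := y))]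
      exact hΦ.map_add_le _ x y)
    (fun c x => by
      rw [← apply_map_sort h0 (Finsupp.support_smul (b := c) (g := x)), Real.norm_eq_abs]
      exact hΦ.map_mul _ c x)

end Words

section Folner

theorem exists_succ_le_mul_of_le_pow {c : ℕ → ℕ} {R : ℕ} (h0 : 0 < c 0)
    (hc : ∀ n, c n ≤ (n + 1) ^ R) {δ : ℝ} (hδ : 0 < δ) : ∃ n, (c (n + 1) : ℝ) ≤ (1 + δ) * c n := by
  by_contra! h
  have h1 : ∀ n, (1 + δ) ^ n ≤ (c n : ℝ) := fun n => by
    induction n with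
    | zero => simpa using Nat.one_le_iff_ne_zero.2 h0.ne'
    | succ n ih =>
      rw [pow_succ']
      exact (mul_le_mul_of_nonneg_left ih (by positivity)).trans (h n).le
  have h2 := (tendsto_pow_const_div_const_pow_of_one_lt R (lt_add_of_pos_right 1 hδ)).comp
    (tendsto_add_atTop_nat 1)
  obtain ⟨n, hn⟩ := (h2.eventually_lt_const (inv_pos.2 (by positivity : 0 < 1 + δ))).exists
  have h3 : (1 + δ) ^ n ≤ ((n : ℝ) + 1) ^ R := (h1 n).trans (by exact_mod_cast hc n)
  simp only [Function.comp_apply, Nat.cast_add, Nat.cast_one] at hn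
  rw [div_lt_iff₀ (by positivity), pow_succ, mul_comm, mul_assoc,
    mul_inv_cancel₀ (by positivity), mul_one] at hn
  linarith

/-- The products of the powers, with exponents at most `M`, of the integers `1, …, R`. -/
def powerProducts (R M : ℕ) : Finset ℕ :=
  (Fintype.piFinset fun _ : Fin R => Finset.range (M + 1)).image fun e =>
    ∏ i : Fin R, ((i : ℕ) + 1) ^ e i

theorem mem_powerProducts {R M m : ℕ} : m ∈ powerProducts R M ↔
    ∃ e : Fin R → ℕ, (∀ i, e i ≤ M) ∧ ∏ i : Fin R, ((i : ℕ) + 1) ^ e i = m := by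
  simp [powerProducts]

theorem powerProducts_subset_succ (R M : ℕ) : powerProducts R M ⊆ powerProducts R (M + 1) := by
  intro m
  simp only [mem_powerProducts]
  rintro ⟨e, he, rfl⟩
  exact ⟨e, fun i => (he i).trans M.le_succ, rfl⟩

theorem image_mul_powerProducts_subset {R r : ℕ} (hr : 0 < r) (hrR : r ≤ R) (M : ℕ) :
    (powerProducts R M).image (r * ·) ⊆ powerProducts R (M + 1) := by
  intro m
  simp only [Finset.mem_image, mem_powerProducts]
  rintro ⟨_, ⟨e, he, rfl⟩, rfl⟩
  refine ⟨e + Pi.single ⟨r - 1, by omega⟩ 1, fun i => ?_, ?_⟩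
  · have : (Pi.single ⟨r - 1, by omega⟩ 1 : Fin R → ℕ) i ≤ 1 := by
      rw [Pi.single_apply]; split_ifs <;> omega
    exact add_le_add (he i) this
  · simp only [Pi.add_apply, pow_add, Finset.prod_mul_distrib]
    rw [mul_comm, Finset.prod_eq_single_of_mem (⟨r - 1, by omega⟩ : Fin R) (Finset.mem_univ _)
      fun j _ hj => by rw [Pi.single_eq_of_ne hj, pow_zero]]
    simp [Nat.sub_add_cancel hr]

/-- The multiplicative semigroup of positive integers admits Følner sets. -/
theorem exists_folner (R : ℕ) {δ : ℝ} (hδ : 0 < δ) :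
    ∃ F : Finset ℕ, F.Nonempty ∧ (∀ s ∈ F, 0 < s) ∧ ∀ r, 0 < r → r ≤ R →
      ((F.image (r * ·) \ F).card : ℝ) ≤ δ * F.card ∧
        ((F \ F.image (r * ·)).card : ℝ) ≤ δ * F.card := by
  have hne : ∀ M, (powerProducts R M).Nonempty := fun M =>
    ⟨_, mem_powerProducts.2 ⟨0, fun _ => M.zero_le, rfl⟩⟩
  obtain ⟨M, hM⟩ := exists_succ_le_mul_of_le_pow (c := fun M => (powerProducts R M).card) (R := R)
    (hne 0).card_pos (fun M => Finset.card_image_le.trans (by simp)) hδ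
  refine ⟨powerProducts R M, hne M, fun s hs => ?_, fun r hr hrR => ?_⟩
  · obtain ⟨e, -, rfl⟩ := mem_powerProducts.1 hs
    positivity
  · have hcard : ((powerProducts R M).image (r * ·)).card = (powerProducts R M).card :=
      Finset.card_image_of_injective _ fun a b h => Nat.eq_of_mul_eq_mul_left hr h
    have h1 : ((powerProducts R M).image (r * ·) \ powerProducts R M).card +
        (powerProducts R M).card ≤ (powerProducts R (M + 1)).card := by
      rw [← Finset.card_sdiff_add_card_eq_card (powerProducts_subset_succ R M)]
      gcongr
      exact image_mul_powerProducts_subset hr hrR M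
    have h2 : (((powerProducts R M).image (r * ·) \ powerProducts R M).card : ℝ) ≤
        δ * (powerProducts R M).card := by
      have : ((((powerProducts R M).image (r * ·) \ powerProducts R M).card : ℝ) +
        (powerProducts R M).card) ≤ (powerProducts R (M + 1)).card := by exact_mod_cast h1
      linarith
    exact ⟨h2, by rwa [Finset.card_sdiff_comm hcard.symm]⟩

end Folner

section Blocks

theorem powSum_sum_single {p : ℝ} (hp : 1 ≤ p) {ι κ : Type*} (I : Finset ι) {f : ι → κ}
    (hf : Set.InjOn f I) (c : ι → ℝ) :
    powSum p (∑ i ∈ I, Finsupp.single (f i) (c i)) = ∑ i ∈ I, |c i| ^ p := by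
  classical
  induction I using Finset.induction_on with
  | empty => simp [powSum]
  | insert i I hi ih =>
    rw [Finset.sum_insert hi, Finset.sum_insert hi, add_comm, powSum_add_single hp, add_comm,
      ih (hf.mono (by simp))]
    intro h
    obtain ⟨j, hj, hj'⟩ := Finset.mem_biUnion.1 (Finsupp.support_finsetSum h)
    have h1 := hf (by simp) (by simp [hj])
      (Finset.mem_singleton.1 (Finsupp.support_single_subset hj'))
    exact hi (h1 ▸ hj)

/-- The `j`-th of `s` equidistant points of `(0, 1)`. The offset is irrational, so that the points
for different values of `s` are different. -/
def gridPoint (s j : ℕ) : ℝ := (√2 - 1 + j) / s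

theorem gridPoint_injective {s t i j : ℕ} (hs : 0 < s) (ht : 0 < t)
    (h : gridPoint s i = gridPoint t j) : s = t ∧ i = j := by
  have hs' : (s : ℝ) ≠ 0 := by positivity
  have ht' : (t : ℝ) ≠ 0 := by positivity
  rw [gridPoint, gridPoint, div_eq_div_iff hs' ht'] at h
  have hst : s = t := by
    by_contra hne
    have hne' : (t : ℝ) - s ≠ 0 := sub_ne_zero.2 fun h => hne (by exact_mod_cast h.symm)
    refine irrational_sqrt_two ⟨1 + (j * s - i * t) / (t - s), ?_⟩
    push_cast
    field_simp
    linarith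
  subst hst
  exact ⟨rfl, by simpa using mul_right_cancel₀ hs' h⟩

theorem gridPoint_mem_Ioo {s j : ℕ} (h : j < s) : gridPoint s j ∈ Set.Ioo (0 : ℝ) 1 := by
  have hs : (0 : ℝ) < s := by exact_mod_cast (by omega : 0 < s)
  have h' : (j : ℝ) + 1 ≤ s := by exact_mod_cast h
  have h1 : (1 : ℝ) < √2 := Real.lt_sqrt_of_sq_lt (by norm_num)
  have h2 : √2 < 2 := (Real.sqrt_lt' (by norm_num)).2 (by norm_num)
  have h0 : (0 : ℝ) ≤ j := j.cast_nonneg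
  exact ⟨div_pos (by linarith) hs, by rw [gridPoint, div_lt_one hs]; linarith⟩

/-- The indicator function of the grid of `s` equidistant points. -/
def gridIndicator (s : ℕ) : ℝ →₀ ℝ := ∑ j ∈ Finset.range s, Finsupp.single (gridPoint s j) 1

theorem concat_gridIndicator (r s : ℕ) :
    concat r (gridIndicator s) = gridIndicator (r * s) := by
  have key : ∀ (f : ℕ → ℝ →₀ ℝ) (n : ℕ),
      ∑ j ∈ Finset.range n, ∑ i ∈ Finset.range s, f (s * j + i) =
        ∑ i ∈ Finset.range (n * s), f i := fun f n => by
    induction n with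
    | zero => simp
    | succ n ih => rw [Finset.sum_range_succ, ih, Nat.succ_mul, Finset.sum_range_add, mul_comm s]
  rw [concat_apply, show gridIndicator (r * s) = _ from (key _ r).symm]
  refine Finset.sum_congr rfl fun j hj => ?_
  rw [gridIndicator, Finsupp.mapDomain_finsetSum]
  refine Finset.sum_congr rfl fun i hi => ?_
  have hr : (r : ℝ) ≠ 0 := by have := Finset.mem_range.1 hj; norm_cast; omega
  have hs : (s : ℝ) ≠ 0 := by have := Finset.mem_range.1 hi; norm_cast; omega
  rw [Finsupp.mapDomain_single]
  congr 1
  simp only [gridPoint]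
  push_cast
  field_simp
  ring

/-- The combination of grids with coefficients of the form `s ^ (-1 / p)`. -/
def gridSum (p : ℝ) (F : Finset ℕ) : ℝ →₀ ℝ :=
  ∑ s ∈ F, (s : ℝ) ^ (-(1 / p)) • gridIndicator s

theorem mem_Ioo_of_mem_support_gridSum {p : ℝ} {F : Finset ℕ} :
    ∀ t ∈ (gridSum p F).support, t ∈ Set.Ioo (0 : ℝ) 1 := by
  classical
  intro t ht
  obtain ⟨s, -, hs⟩ := Finset.mem_biUnion.1 (Finsupp.support_finsetSum ht)
  obtain ⟨j, hj, h⟩ := Finset.mem_biUnion.1 (Finsupp.support_finsetSum (Finsupp.support_smul hs))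
  rw [Finset.mem_singleton.1 (Finsupp.support_single_subset h)]
  exact gridPoint_mem_Ioo (Finset.mem_range.1 hj)

theorem powSum_gridSum {p : ℝ} (hp : 1 ≤ p) {F : Finset ℕ} (hF : ∀ s ∈ F, 0 < s) :
    powSum p (gridSum p F) = F.card := by
  have hp0 : p ≠ 0 := by linarith
  have h : gridSum p F = ∑ x ∈ F.sigma fun s => Finset.range s,
      Finsupp.single (gridPoint x.1 x.2) ((x.1 : ℝ) ^ (-(1 / p))) := by
    simp [gridSum, gridIndicator, Finset.sum_sigma, Finset.smul_sum]
  rw [h, powSum_sum_single hp, Finset.sum_sigma, Finset.card_eq_sum_ones, Nat.cast_sum]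
  · refine Finset.sum_congr rfl fun s hs => ?_
    have hs' : (0 : ℝ) < s := by exact_mod_cast hF s hs
    dsimp only
    rw [Finset.sum_const, Finset.card_range, nsmul_eq_mul, abs_of_nonneg (by positivity),
      ← Real.rpow_mul hs'.le]
    rw [neg_mul, one_div_mul_cancel hp0, Real.rpow_neg_one, mul_inv_cancel₀ hs'.ne', Nat.cast_one]
  · rintro ⟨s, i⟩ hs ⟨t, j⟩ ht hst
    simp only [Finset.coe_sigma, Set.mem_sigma_iff, Finset.mem_coe] at hs ht
    obtain ⟨rfl, rfl⟩ := gridPoint_injective (hF s hs.1) (hF t ht.1) hst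
    rfl

theorem concat_gridSum_sub {p : ℝ} (F : Finset ℕ) {r : ℕ} (hr : 0 < r) :
    concat r (gridSum p F) - (r : ℝ) ^ (1 / p) • gridSum p F =
      (r : ℝ) ^ (1 / p) • (gridSum p (F.image (r * ·) \ F) - gridSum p (F \ F.image (r * ·))) := by
  have h : concat r (gridSum p F) = (r : ℝ) ^ (1 / p) • gridSum p (F.image (r * ·)) := by
    rw [gridSum, gridSum, Finset.sum_image fun a _ b _ h => Nat.eq_of_mul_eq_mul_left hr h,
      map_sum, Finset.smul_sum]
    refine Finset.sum_congr rfl fun s _ => ?_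
    have hr' : (0 : ℝ) < r := by exact_mod_cast hr
    rw [map_smul, concat_gridIndicator, smul_smul, Nat.cast_mul,
      Real.mul_rpow hr'.le (by positivity), ← mul_assoc, ← Real.rpow_add hr', add_neg_cancel,
      Real.rpow_zero, one_mul]
  rw [h, ← smul_sub, gridSum, gridSum, gridSum, gridSum, Finset.sum_sdiff_sub_sum_sdiff]

end Blocks

section Seminorms

variable {N : Seminorm ℝ (ℝ →₀ ℝ)} {p C : ℝ}

/-- For a seminorm equivalent to the `ℓ_p` norm, there are functions that are almost
eigenvectors of all the maps `concat r` with `r ≤ R`, with eigenvalue `r ^ (1 / p)`. -/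
theorem exists_concat_almost_eigenvector (hp : 1 ≤ p) (hC : 0 < C)
    (hu : ∀ x, N x ≤ powSum p x ^ (1 / p)) (hl : ∀ x, powSum p x ^ (1 / p) ≤ C * N x) (R : ℕ)
    {η : ℝ} (hη : 0 < η) :
    ∃ u : ℝ →₀ ℝ, (∀ t ∈ u.support, t ∈ Set.Ioo (0 : ℝ) 1) ∧ N u = 1 ∧
      ∀ r ≤ R, N (concat r u - (r : ℝ) ^ (1 / p) • u) ≤ η := by
  have hp0 : 0 < p := by linarith
  set θ : ℝ := η / (2 * C * (R + 1)) with hθ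
  have hθ0 : 0 < θ := by positivity
  obtain ⟨F, hFne, hF, hFr⟩ := exists_folner R (Real.rpow_pos_of_pos hθ0 p)
  have hcard : (0 : ℝ) < F.card := by exact_mod_cast hFne.card_pos
  set A : ℝ := (F.card : ℝ) ^ (1 / p) with hA
  have hA0 : 0 < A := by positivity
  have hN : A ≤ C * N (gridSum p F) := by
    simpa only [powSum_gridSum hp hF] using hl (gridSum p F)
  have hN0 : 0 < N (gridSum p F) := pos_of_mul_pos_right (hA0.trans_le hN) hC.le
  have hsmall : ∀ G : Finset ℕ, (∀ s ∈ G, 0 < s) → (G.card : ℝ) ≤ θ ^ p * F.card →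
      N (gridSum p G) ≤ θ * A := fun G hG hGF => by
    refine (hu _).trans ?_
    rw [powSum_gridSum hp hG]
    refine (Real.rpow_le_rpow (by positivity) hGF (by positivity)).trans_eq ?_
    rw [Real.mul_rpow (by positivity) (by positivity), one_div,
      Real.rpow_rpow_inv hθ0.le hp0.ne', hA, one_div]
  refine ⟨(N (gridSum p F))⁻¹ • gridSum p F,
    fun t ht => mem_Ioo_of_mem_support_gridSum t (Finsupp.support_smul ht), ?_, fun r hr => ?_⟩
  · rw [map_smul_eq_mul, Real.norm_eq_abs, abs_of_pos (inv_pos.2 hN0), inv_mul_cancel₀ hN0.ne']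
  · rcases r.eq_zero_or_pos with rfl | hr0
    · simp [concat, hη.le, hp0.ne']
    obtain ⟨h1, h2⟩ := hFr r hr0 hr
    have hr1 : (r : ℝ) ^ (1 / p) ≤ R + 1 := by
      have h1r : (1 : ℝ) ≤ r := by exact_mod_cast hr0
      have hrR : (r : ℝ) ≤ R := by exact_mod_cast hr
      have := Real.rpow_le_rpow_of_exponent_le h1r ((div_le_one hp0).2 hp)
      rw [Real.rpow_one] at this
      linarith
    rw [map_smul, smul_comm, ← smul_sub, concat_gridSum_sub F hr0, map_smul_eq_mul,
      map_smul_eq_mul, Real.norm_eq_abs, Real.norm_eq_abs, abs_of_pos (inv_pos.2 hN0),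
      abs_of_nonneg (by positivity : (0 : ℝ) ≤ (r : ℝ) ^ (1 / p)), inv_mul_le_iff₀ hN0]
    have h3 : N (gridSum p (F.image (r * ·) \ F) - gridSum p (F \ F.image (r * ·))) ≤
        θ * A + θ * A := by
      refine (map_sub_le_add N _ _).trans (add_le_add (hsmall _ ?_ h1) (hsmall _ ?_ h2))
      · intro s hs
        obtain ⟨t, ht, rfl⟩ := Finset.mem_image.1 (Finset.mem_sdiff.1 hs).1
        exact Nat.mul_pos hr0 (hF t ht)
      · exact fun s hs => hF s (Finset.mem_sdiff.1 hs).1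
    calc (r : ℝ) ^ (1 / p) * N _ ≤ (R + 1) * (θ * A + θ * A) := by gcongr
      _ = η / C * A := by rw [hθ]; field_simp; ring
      _ ≤ η / C * (C * N (gridSum p F)) := by gcongr
      _ = N (gridSum p F) * η := by field_simp

theorem map_sum_le_sum {E : Type*} [AddCommGroup E] [Module ℝ E] (N : Seminorm ℝ E) {ι : Type*}
    (s : Finset ι) (f : ι → E) : N (∑ i ∈ s, f i) ≤ ∑ i ∈ s, N (f i) :=
  Finset.le_sum_of_subadditive N (map_zero N).le (map_add_le_add N) s f

variable {u : ℝ →₀ ℝ}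

theorem abs_map_sum_shift_sub_le (hword : ∀ x y, word x = word y → N x = N y)
    (hu01 : ∀ t ∈ u.support, t ∈ Set.Ioo (0 : ℝ) 1) (hu1 : N u = 1) {R : ℕ} {η : ℝ}
    (hη : ∀ r ≤ R, N (concat r u - (r : ℝ) ^ (1 / p) • u) ≤ η) (k : ℕ) (r : ℕ → ℕ)
    (hr : ∑ i ∈ Finset.range k, r i ≤ R) :
    |N (∑ i ∈ Finset.range k, (r i : ℝ) ^ (1 / p) • shift i u) -
      ((∑ i ∈ Finset.range k, r i : ℕ) : ℝ) ^ (1 / p)| ≤ (k + 1) * η := by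
  set s := ∑ i ∈ Finset.range k, r i
  have h1 : |N (∑ i ∈ Finset.range k, (r i : ℝ) ^ (1 / p) • shift i u) -
      N (∑ i ∈ Finset.range k, shift i (concat (r i) u))| ≤ k * η := by
    rw [abs_sub_comm]
    refine (abs_sub_map_le_sub N _ _).trans ?_
    rw [← Finset.sum_sub_distrib]
    refine (map_sum_le_sum N _ _).trans ((Finset.sum_le_card_nsmul _ _ η fun i hi => ?_).trans_eq
      (by simp))
    rw [← map_smul, ← map_sub, hword _ _ (word_shift i _)]
    exact hη _ ((Finset.single_le_sum (fun _ _ => Nat.zero_le _) hi).trans hr)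
  have h2 : |N (concat s u) - (s : ℝ) ^ (1 / p)| ≤ η := by
    have h := (abs_sub_map_le_sub N _ _).trans (hη s hr)
    rwa [map_smul_eq_mul, hu1, mul_one, Real.norm_eq_abs,
      abs_of_nonneg (Real.rpow_nonneg s.cast_nonneg _)] at h
  rw [hword _ _ (word_sum_shift_concat hu01 r k)] at h1
  refine (abs_sub_le _ _ _).trans ((add_le_add h1 h2).trans_eq (by ring))

theorem tendsto_floor_rpow (hp : 1 ≤ p) (a : ℝ) :
    Tendsto (fun D : ℕ => (⌊|a| ^ p * D⌋₊ / D : ℝ) ^ (1 / p)) atTop (𝓝 |a|) := by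
  have hp0 : 0 < p := by linarith
  have h := (tendsto_nat_floor_mul_div_atTop (R := ℝ) (a := |a| ^ p) (by positivity)).comp
    tendsto_natCast_atTop_atTop
  have h2 := h.rpow_const (p := 1 / p) (Or.inr (by positivity))
  rwa [one_div, Real.rpow_rpow_inv (abs_nonneg a) hp0.ne', ← one_div] at h2

theorem tendsto_sum_floor_rpow (hp : 1 ≤ p) (a : ℕ → ℝ) (k : ℕ) :
    Tendsto (fun D : ℕ => ((∑ i ∈ Finset.range k, ⌊|a i| ^ p * D⌋₊ : ℕ) / D : ℝ) ^ (1 / p)) atTop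
      (𝓝 ((∑ i ∈ Finset.range k, |a i| ^ p) ^ (1 / p))) := by
  have hp0 : 0 < p := by linarith
  refine Tendsto.rpow_const ?_ (Or.inr (by positivity))
  simp only [Nat.cast_sum, Finset.sum_div]
  exact tendsto_finsetSum _ fun i _ =>
    (tendsto_nat_floor_mul_div_atTop (R := ℝ) (a := |a i| ^ p) (by positivity)).comp
      tendsto_natCast_atTop_atTop

/-- Approximate by a combination with coefficients of the form `(r / D) ^ (1 / p)`. -/
theorem abs_map_sum_shift_sub_le_of_floor (hword : ∀ x y, word x = word y → N x = N y)
    (habs : ∀ x y : ℝ →₀ ℝ, (∀ t, |x t| = |y t|) → N x = N y)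
    (hu01 : ∀ t ∈ u.support, t ∈ Set.Ioo (0 : ℝ) 1) (hu1 : N u = 1) {R : ℕ} {η δ : ℝ}
    (hp : 1 ≤ p)
    (hη : ∀ r ≤ R, N (concat r u - (r : ℝ) ^ (1 / p) • u) ≤ η) (k : ℕ) (a : ℕ → ℝ) {D : ℕ}
    (hD : 0 < D) (hr : ∑ i ∈ Finset.range k, ⌊|a i| ^ p * D⌋₊ ≤ R)
    (h1 : ∀ i ∈ Finset.range k, |(⌊|a i| ^ p * D⌋₊ / D : ℝ) ^ (1 / p) - (|a i|)| ≤ δ)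
    (h2 : |((∑ i ∈ Finset.range k, ⌊|a i| ^ p * D⌋₊ : ℕ) / D : ℝ) ^ (1 / p) -
      (∑ i ∈ Finset.range k, |a i| ^ p) ^ (1 / p)| ≤ δ) :
    |N (∑ i ∈ Finset.range k, a i • shift i u) - (∑ i ∈ Finset.range k, |a i| ^ p) ^ (1 / p)| ≤
      (k + 1) * (δ + η) := by
  have hD' : (1 : ℝ) ≤ D := by exact_mod_cast hD
  have hD0 : (0 : ℝ) < D := by positivity
  rw [habs _ _ (abs_sum_smul_shift_apply hu01 a k)]
  set r : ℕ → ℕ := fun i => ⌊|a i| ^ p * D⌋₊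
  set c : ℝ := (D : ℝ) ^ (1 / p)
  have hc1 : 1 ≤ c := Real.one_le_rpow hD' (by positivity)
  have hc0 : 0 < c := by positivity
  have hdiv : ∀ n : ℕ, (n / D : ℝ) ^ (1 / p) = c⁻¹ * (n : ℝ) ^ (1 / p) := fun n => by
    rw [Real.div_rpow n.cast_nonneg hD0.le, div_eq_inv_mul]
  have h3 : |N (∑ i ∈ Finset.range k, |a i| • shift i u) -
      N (∑ i ∈ Finset.range k, (r i / D : ℝ) ^ (1 / p) • shift i u)| ≤ k * δ := by
    refine (abs_sub_map_le_sub N _ _).trans ?_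
    rw [← Finset.sum_sub_distrib]
    refine (map_sum_le_sum N _ _).trans ((Finset.sum_le_card_nsmul _ _ δ fun i hi => ?_).trans_eq
      (by simp))
    rw [← sub_smul, map_smul_eq_mul, hword _ _ (word_shift i _), hu1, mul_one, Real.norm_eq_abs,
      abs_sub_comm]
    exact h1 i hi
  have h4 : |N (∑ i ∈ Finset.range k, (r i / D : ℝ) ^ (1 / p) • shift i u) -
      ((∑ i ∈ Finset.range k, r i : ℕ) / D : ℝ) ^ (1 / p)| ≤ (k + 1) * η := by
    simp only [hdiv, mul_smul]
    rw [← Finset.smul_sum, map_smul_eq_mul, Real.norm_eq_abs, abs_of_pos (inv_pos.2 hc0), ← mul_sub,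
      abs_mul, abs_of_pos (inv_pos.2 hc0)]
    exact (mul_le_of_le_one_left (abs_nonneg _) (inv_le_one_of_one_le₀ hc1)).trans
      (abs_map_sum_shift_sub_le hword hu01 hu1 hη k r hr)
  have h5 := (abs_sub_le _ _ _).trans (add_le_add ((abs_sub_le _ _ _).trans (add_le_add h3 h4)) h2)
  linarith

theorem exists_almost_isometric_shifts (hp : 1 ≤ p) (hC : 0 < C)
    (hu : ∀ x, N x ≤ powSum p x ^ (1 / p)) (hl : ∀ x, powSum p x ^ (1 / p) ≤ C * N x)
    (hword : ∀ x y, word x = word y → N x = N y)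
    (habs : ∀ x y : ℝ →₀ ℝ, (∀ t, |x t| = |y t|) → N x = N y) (k : ℕ) (Λ : Finset (ℕ → ℝ)) {δ : ℝ}
    (hδ : 0 < δ) :
    ∃ u : ℝ →₀ ℝ, ∀ a ∈ Λ, |N (∑ i ∈ Finset.range k, a i • shift i u) -
      (∑ i ∈ Finset.range k, |a i| ^ p) ^ (1 / p)| ≤ δ := by
  set η : ℝ := δ / (2 * (k + 1)) with hη
  have hη0 : 0 < η := by positivity
  have hev : ∀ᶠ D : ℕ in atTop, ∀ a ∈ Λ,
      (∀ i ∈ Finset.range k, |(⌊|a i| ^ p * D⌋₊ / D : ℝ) ^ (1 / p) - (|a i|)| ≤ η) ∧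
      |((∑ i ∈ Finset.range k, ⌊|a i| ^ p * D⌋₊ : ℕ) / D : ℝ) ^ (1 / p) -
        (∑ i ∈ Finset.range k, |a i| ^ p) ^ (1 / p)| ≤ η := by
    rw [eventually_all_finset]
    refine fun a _ => Eventually.and ?_ ?_
    · rw [eventually_all_finset]
      intro i _
      filter_upwards [Metric.tendsto_nhds.1 (tendsto_floor_rpow hp (a i)) η hη0] with D hD
        using (Real.dist_eq _ _ ▸ hD).le
    · filter_upwards [Metric.tendsto_nhds.1 (tendsto_sum_floor_rpow hp a k) η hη0] with D hD
        using (Real.dist_eq _ _ ▸ hD).le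
  obtain ⟨D, hD, hD0⟩ := (hev.and (eventually_gt_atTop 0)).exists
  obtain ⟨u, hu01, hu1, huR⟩ := exists_concat_almost_eigenvector hp hC hu hl
    (∑ a ∈ Λ, ∑ i ∈ Finset.range k, ⌊|a i| ^ p * D⌋₊) hη0
  refine ⟨u, fun a ha => (abs_map_sum_shift_sub_le_of_floor hword habs hu01 hu1 hp huR k a
    hD0 ?_ (hD a ha).1 (hD a ha).2).trans_eq (by rw [hη]; field_simp; ring)⟩
  exact Finset.single_le_sum (f := fun a : ℕ → ℝ => ∑ i ∈ Finset.range k, ⌊|a i| ^ p * D⌋₊)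
    (fun _ _ => Nat.zero_le _) ha

end Seminorms

section Krivine

variable {p : ℝ≥0∞}

theorem norm_eq_rpow_sum_range [Fact (1 ≤ p)] (hp : p ≠ ∞) {k : ℕ}
    (a : PiLp p (fun _ : Fin k => ℝ)) (b : ℕ → ℝ) (h : ∀ i : Fin k, a i = b i) :
    ‖a‖ = (∑ i ∈ Finset.range k, |b i| ^ p.toReal) ^ (1 / p.toReal) := by
  rw [PiLp.norm_eq_sum (ENNReal.toReal_pos (zero_lt_one.trans_le Fact.out).ne' hp),
    Finset.sum_range]
  simp [h]

theorem one_le_toReal [h : Fact (1 ≤ p)] (hp : p ≠ ∞) : 1 ≤ p.toReal :=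
  ENNReal.toReal_mono hp h.out

theorem eventually_norm_restrictLp [Fact (1 ≤ p)] (hp : p ≠ ∞) (v : ℕ →₀ ℝ) :
    ∀ᶠ n in atTop, ‖restrictLp p n v‖ = powSum p.toReal v ^ (1 / p.toReal) := by
  filter_upwards [v.eventually_eq_zero_of_le] with n hn
  have h0 : p.toReal ≠ 0 := (zero_lt_one.trans_le (one_le_toReal hp)).ne'
  rw [norm_eq_rpow_sum_range hp _ v fun i => rfl, powSum, Finsupp.sum_of_support_subset v
    (s := Finset.range n) _ _ fun i _ => by rw [abs_zero, Real.zero_rpow h0]]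
  intro i hi
  by_contra h
  exact Finsupp.mem_support_iff.1 hi (hn i (by simpa using h))

theorem exists_almost_isometric_lp [Fact (1 ≤ p)] (hp : p ≠ ∞) (q : Seminorm ℝ (ℕ →₀ ℝ)) {C : ℝ}
    (hC : 0 < C) (hu : ∀ v, q v ≤ powSum p.toReal v ^ (1 / p.toReal))
    (hl : ∀ v, powSum p.toReal v ^ (1 / p.toReal) ≤ C * q v) (k : ℕ)
    (Λ : Finset (PiLp p (fun _ : Fin k => ℝ))) (δ : ℝ) (hδ : 0 < δ) :
    ∃ B : PiLp p (fun _ : Fin k => ℝ) →ₗ[ℝ] (ℕ →₀ ℝ), ∀ a ∈ Λ, |q (B a) - ‖a‖| ≤ δ := by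
  classical
  have hp1 := one_le_toReal hp
  obtain ⟨Φ, hΦ, h0, hs⟩ := exists_realizes_symmetric hp1 hC hu hl
  have hN : ∀ x, spreadSeminorm hΦ h0 x = Φ (word x) := fun _ => rfl
  let b : PiLp p (fun _ : Fin k => ℝ) → ℕ → ℝ := fun a i => if h : i < k then a ⟨i, h⟩ else 0
  have hb : ∀ a (i : Fin k), a i = b a i := fun a i => by simp [b]
  obtain ⟨u, hu⟩ := exists_almost_isometric_shifts (N := spreadSeminorm hΦ h0) hp1 hC
    (fun x => by rw [hN, ← sum_map_word]; exact hΦ.le_rpow_sum hu _)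
    (fun x => by rw [hN, ← sum_map_word]; exact hΦ.rpow_sum_le hC hl _)
    (fun x y h => by rw [hN, hN, h])
    (fun x y h => by
      rw [hN, hN, ← apply_map_sort h0 (Finset.subset_union_left (s₂ := y.support)),
        ← apply_map_sort h0 (Finset.subset_union_right (s₁ := x.support))]
      exact apply_map_eq_of_abs_eq hs h _ [])
    k (Λ.image b) (half_pos hδ)
  let S : Finset ℝ := (Finset.range k).biUnion fun i => (shift i u).support
  let g : ℝ → PiLp p (fun _ : Fin k => ℝ) →ₗ[ℝ] ℝ := fun t =>
    ∑ i : Fin k, (shift i u t) • PiLp.projₗ p (fun _ : Fin k => ℝ) i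
  have hg : ∀ a t, g t a = (∑ i ∈ Finset.range k, b a i • shift i u) t := fun a t => by
    simp [g, Finset.sum_range, hb, mul_comm, Finsupp.finsetSum_apply]
  obtain ⟨B, -, hB⟩ := hΦ _ (S.sort.map g) Λ (δ / 2) (half_pos hδ)
  refine ⟨B, fun a ha => ?_⟩
  have h1 := hB a ha
  have hS : (∑ i ∈ Finset.range k, b a i • shift i u).support ⊆ S :=
    Finsupp.support_finsetSum.trans (Finset.biUnion_mono fun i _ => Finsupp.support_smul)
  rw [List.map_map, show (fun g => g a) ∘ g = _ from funext (hg a), apply_map_sort h0 hS,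
    ← hN] at h1
  have h2 := hu (b a) (Finset.mem_image_of_mem b ha)
  rw [← norm_eq_rpow_sum_range hp a _ (hb a)] at h2
  linarith [abs_sub_le (q (B a))
    (spreadSeminorm hΦ h0 (∑ i ∈ Finset.range k, b a i • shift i u)) ‖a‖]

end Krivine

/-- a finite quantitative version of Krivine's theorem.
For `1 ≤ p ≤ ∞`, `C ≥ 1`, `ε > 0` and `k ∈ ℕ` there is `n ∈ ℕ` such that any Banach
space `C`-isomorphic to `ℓ_p^n` has a subspace `(1+ε)`-isomorphic to `ℓ_p^k`. -/
theorem stmt14 (p : ℝ≥0∞) [Fact (1 ≤ p)] (C : ℝ) (hC : 1 ≤ C) (ε : ℝ) (hε : 0 < ε)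
    (k : ℕ) :
    ∃ n : ℕ, ∀ (X : Type) [NormedAddCommGroup X] [NormedSpace ℝ X] [CompleteSpace X],
      (∃ T : PiLp p (fun _ : Fin n => ℝ) ≃L[ℝ] X,
        ‖(T : PiLp p (fun _ : Fin n => ℝ) →L[ℝ] X)‖ *
          ‖(T.symm : X →L[ℝ] PiLp p (fun _ : Fin n => ℝ))‖ ≤ C) →
      ∃ (Z : Submodule ℝ X) (S : PiLp p (fun _ : Fin k => ℝ) ≃L[ℝ] Z),
        ‖(S : PiLp p (fun _ : Fin k => ℝ) →L[ℝ] Z)‖ *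
          ‖(S.symm : Z →L[ℝ] PiLp p (fun _ : Fin k => ℝ))‖ ≤ 1 + ε := by
  have hC0 : 0 < C := by linarith
  by_cases hp : p = ∞
  · subst hp
    exact exists_dim_of_seminorm ∞ C ε hε k _ eventually_norm_restrictLp_top
      fun q hu hl Λ δ hδ => exists_almost_isometric_linfty q hu hl k Λ δ hδ
  · exact exists_dim_of_seminorm p C ε hε k _ (eventually_norm_restrictLp hp)
      fun q hu hl Λ δ hδ => exists_almost_isometric_lp hp q hC0 hu hl k Λ δ hδ
end
end

section
/- Let p = 2 and n ∈ ℕ. Suppose (x_1,…,x_n) ∈ (ℝ^n)^n is a tuple such that for each i, x_i lies in the span of e_1,…,e_i and the coefficient of e_i in x_i is nonzero (where e_1,…,e_n is the standard basis of ℝ^n). Then (x_1,…,x_n) ∈ G_n, i.e., the derivative at (x_1,…,x_n) of the map F_n(z_1,…,z_n) = (‖z_i − z_j‖_2^2)_{1 ≤ i < j ≤ n} from (ℝ^n)^n to ℝ^{n(n−1)/2} has full rank n(n−1)/2. -/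
open MeasureTheory
open scoped ENNReal
noncomputable section

-- test lp coercion and instances

theorem card_pairIdx (n : ℕ) : Fintype.card (PairIdx n) = n * (n - 1) / 2 := by
  have e : PairIdx n ≃ Σ j : Fin n, {i : Fin n // i < j} :=
    { toFun := fun q => ⟨q.1.2, q.1.1, q.2⟩
      invFun := fun s => ⟨(s.2.1, s.1), s.2.2⟩
      left_inv := fun _ => rfl
      right_inv := fun _ => rfl }
  rw [Fintype.card_congr e, Fintype.card_sigma, ← Finset.sum_range_id, Finset.sum_range]
  refine Finset.sum_congr rfl fun j _ => ?_
  rw [Fintype.card_subtype, Finset.filter_gt_eq_Iio, Fin.card_Iio]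

theorem Fmap_two (n : ℕ) :
    Fmap 2 n = fun x q => ∑ k, (x q.val.1 k - x q.val.2 k) ^ 2 := by
  ext x q
  simp [Fmap]

/-- The derivative of `Fmap 2 n` at `x` sends `v` to `2⟨x_i - x_j, v_i - v_j⟩` for `i < j`. -/
theorem fderiv_Fmap_two_apply (n : ℕ) (x v : Fin n → Fin n → ℝ) (q : PairIdx n) :
    fderiv ℝ (Fmap 2 n) x v q =
      2 * ((x q.val.1 - x q.val.2) ⬝ᵥ (v q.val.1 - v q.val.2)) := by
  let P (i k : Fin n) : (Fin n → Fin n → ℝ) →L[ℝ] ℝ :=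
    (ContinuousLinearMap.proj (R := ℝ) (φ := fun _ : Fin n => ℝ) k).comp
      (ContinuousLinearMap.proj (φ := fun _ : Fin n => Fin n → ℝ) i)
  have hcoord (i k : Fin n) : HasFDerivAt (fun y : Fin n → Fin n → ℝ => y i k) (P i k) x :=
    (P i k).hasFDerivAt
  have hF := hasFDerivAt_pi.2 fun q : PairIdx n => HasFDerivAt.fun_sum (u := Finset.univ)
    fun k _ => ((hcoord q.val.1 k).sub (hcoord q.val.2 k)).pow 2
  rw [Fmap_two]
  refine (congrFun (DFunLike.congr_fun hF.fderiv v) q).trans ?_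
  simp [P, dotProduct, Finset.mul_sum, mul_assoc]

theorem fderiv_Fmap_two_surjective (n : ℕ) (x : Fin n → Fin n → ℝ)
    (hx : IsUnit (Matrix.of x).det) :
    Function.Surjective (fderiv ℝ (Fmap 2 n) x) := by
  intro w
  let c : Matrix (Fin n) (Fin n) ℝ := Matrix.of fun j i =>
    if h : i < j then -w ⟨(i, j), h⟩ / 2 else 0
  let v : Fin n → Fin n → ℝ := fun i k => ((Matrix.of x)⁻¹ * c) k i
  have hv (j i : Fin n) : x j ⬝ᵥ v i = c j i := by
    have h := congrFun₂ (Matrix.mul_nonsing_inv_cancel_left (Matrix.of x) c hx) j i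
    rw [Matrix.mul_apply'] at h
    exact h
  refine ⟨v, funext fun q => ?_⟩
  obtain ⟨⟨i, j⟩, hq⟩ := q
  have hq' : i < j := hq
  rw [fderiv_Fmap_two_apply]
  simp only [sub_dotProduct, dotProduct_sub, hv]
  simp only [c, Matrix.of_apply, lt_irrefl, hq', hq'.not_gt, dite_true, dite_false]
  ring

/-- For `p = 2`: if each `x_i` lies in the span of `e₁,…,e_i` with a
nonzero `e_i`-coefficient, then `(x₁,…,xₙ) ∈ G_n`, i.e. the derivative of
`F_n(z₁,…,zₙ) = (‖z_i - z_j‖₂²)_{i<j}` at `x` has full rank `n(n-1)/2`. -/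
theorem stmt15 (n : ℕ) (x : Fin n → Fin n → ℝ)
    (h1 : ∀ i j : Fin n, i < j → x i j = 0) (h2 : ∀ i : Fin n, x i i ≠ 0) :
    x ∈ Gset 2 n := by
  have hdet : IsUnit (Matrix.of x).det := by
    rw [Matrix.det_of_isLowerTriangular (Matrix.of x) fun i j hij => h1 i j hij]
    exact (Finset.prod_ne_zero_iff.2 fun i _ => h2 i).isUnit
  have hsurj : Function.Surjective (fderiv ℝ (Fmap 2 n) x).toLinearMap :=
    fderiv_Fmap_two_surjective n x hdet
  change LinearMap.rank _ = _
  rw [LinearMap.rank, LinearMap.range_eq_top.2 hsurj, rank_top, rank_fun', card_pairIdx]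
end
end
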